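/- arXiv:2506.16089 — 6 statements merged into one kernel-verified Lean document; each statement's English description precedes it below -/
import Mathlib

section
/- Let P be a probability distribution on ℝ^d, absolutely continuous with respect to Lebesgue measure, with everywhere-positive twice continuously differentiable density p, and let s : ℝ^d → ℝ^d be differentiable with a continuous derivative. Assume p(X)s(X) → 0 and p(X)∇log p(X) → 0 as ‖X‖ → ∞, that E_P[‖∇log p(X)‖²] < ∞ and E_P[‖s(X)‖²] < ∞, and that X ↦ tr(∇_X s(X)) is P-integrable. Then E_P[(1/2)‖∇log p(X) − s(X)‖²] = E_P[(1/2)‖∇log p(X)‖² + (1/2)‖s(X)‖² + tr(∇_X s(X))]. In particular, if s = ∇log q for a distribution Q with positive twice continuously differentiable density q, then the Fisher divergence satisfies D_F(P‖Q) = E_P[(1/2)‖∇log p(X)‖²] + E_P[S_H(X,Q)]. -/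
open MeasureTheory ProbabilityTheory Filter Topology
open scoped ENNReal

noncomputable section

/-- Points of `ℝ^d`. -/
abbrev Vec (d : ℕ) : Type := Fin d → ℝ

/-- Score function `∇ log p`. -/
def score {d : ℕ} (p : Vec d → ℝ) (x : Vec d) : Vec d :=
  fun i => fderiv ℝ (fun y => Real.log (p y)) x (Pi.single i 1)

/-- Trace of the Jacobian of `s : ℝ^d → ℝ^d` at `x`. -/
def trJac {d : ℕ} (s : Vec d → Vec d) (x : Vec d) : ℝ :=
  ∑ i, fderiv ℝ (fun y => s y i) x (Pi.single i 1)

theorem tendsto_inv_natCast_add_one : Tendsto (fun n : ℕ => ((n : ℝ) + 1)⁻¹) atTop (𝓝 0) := by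
  simpa only [one_div] using tendsto_one_div_add_atTop_nhds_zero_nat (𝕜 := ℝ)

/-- Integration of `div F` against a compactly supported `C¹` function. -/
theorem integral_mul_trJac_eq_neg {d : ℕ} {F : Vec d → Vec d} (hF : ContDiff ℝ 1 F)
    {χ : Vec d → ℝ} (hχ : ContDiff ℝ 1 χ) (hχs : HasCompactSupport χ) :
    ∫ x, χ x * trJac F x = -∫ x, ∑ i, fderiv ℝ χ x (Pi.single i 1) * F x i := by
  have hFi : ∀ i, ContDiff ℝ 1 (fun x => F x i) := fun i => contDiff_pi.1 hF i
  have hdF : ∀ i, Continuous fun x => fderiv ℝ (fun y => F y i) x (Pi.single i 1) := fun i =>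
    ((hFi i).continuous_fderiv one_ne_zero).clm_apply continuous_const
  have hdχ : ∀ i : Fin d, Continuous fun x => fderiv ℝ χ x (Pi.single i 1) := fun i =>
    (hχ.continuous_fderiv one_ne_zero).clm_apply continuous_const
  have hdχs : ∀ i : Fin d, HasCompactSupport fun x => fderiv ℝ χ x (Pi.single i 1) := fun i =>
    hχs.fderiv_apply ℝ _
  have h₁ : ∀ i, Integrable fun x => fderiv ℝ χ x (Pi.single i 1) * F x i := fun i =>
    ((hdχ i).mul (hFi i).continuous).integrable_of_hasCompactSupport (hdχs i).mul_right
  have h₂ : ∀ i, Integrable fun x =>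
      χ x * fderiv ℝ (fun y => F y i) x (Pi.single i 1) := fun i =>
    (hχ.continuous.mul (hdF i)).integrable_of_hasCompactSupport hχs.mul_right
  have h₃ : ∀ i, Integrable fun x => χ x * F x i := fun i =>
    (hχ.continuous.mul (hFi i).continuous).integrable_of_hasCompactSupport hχs.mul_right
  simp only [trJac, Finset.mul_sum]
  rw [integral_finsetSum _ fun i _ => h₂ i, integral_finsetSum _ fun i _ => h₁ i,
    ← Finset.sum_neg_distrib]
  exact Finset.sum_congr rfl fun i _ =>
    integral_mul_fderiv_eq_neg_fderiv_mul_of_integrable (h₁ i) (h₂ i) (h₃ i)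
      (fun x _ => hχ.differentiable one_ne_zero x)
      (fun x _ => (hFi i).differentiable one_ne_zero x)

/-- The divergence theorem on the whole space: an integrable `C¹` vector field with integrable
divergence has divergence of integral zero. -/
theorem integral_trJac_eq_zero {d : ℕ} {F : Vec d → Vec d} (hF : ContDiff ℝ 1 F)
    (hint : ∀ i, Integrable fun x => F x i) (hdiv : Integrable (trJac F)) :
    ∫ x, trJac F x = 0 := by
  let φ : ContDiffBump (0 : Vec d) := ⟨1, 2, one_pos, one_lt_two⟩
  have hφ : ContDiff ℝ 1 φ := φ.contDiff
  obtain ⟨C, hC⟩ := (φ.hasCompactSupport.fderiv ℝ).exists_bound_of_continuous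
    (hφ.continuous_fderiv one_ne_zero)
  have hC0 : 0 ≤ C := (norm_nonneg _).trans (hC 0)
  let c : ℕ → ℝ := fun n => ((n : ℝ) + 1)⁻¹
  have hc : Tendsto c atTop (𝓝 0) := tendsto_inv_natCast_add_one
  have hc0 : ∀ n, 0 < c n := fun n => by positivity
  have hc1 : ∀ n, c n ≤ 1 := fun n => inv_le_one_of_one_le₀ (by simp)
  let χ : ℕ → Vec d → ℝ := fun n x => φ (c n • x)
  have hχ : ∀ n, ContDiff ℝ 1 (χ n) := fun n => hφ.comp (contDiff_const_smul (c n))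
  have hχs : ∀ n, HasCompactSupport (χ n) := fun n =>
    φ.hasCompactSupport.comp_smul (hc0 n).ne'
  have hdχ : ∀ n x (i : Fin d), |fderiv ℝ (χ n) x (Pi.single i 1)| ≤ c n * C := by
    intro n x i
    have h : fderiv ℝ (χ n) x = c n • fderiv ℝ φ (c n • x) := fderiv_comp_smul (c n)
    rw [h, smul_apply, smul_eq_mul, abs_mul, abs_of_pos (hc0 n)]
    gcongr
    refine ((fderiv ℝ φ (c n • x)).le_opNorm _).trans ?_
    simpa [Pi.norm_single] using hC (c n • x)
  have hlim_left : Tendsto (fun n => ∫ x, χ n x * trJac F x) atTop (𝓝 (∫ x, trJac F x)) := by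
    refine tendsto_integral_of_dominated_convergence (fun x => ‖trJac F x‖)
      (fun n => (hχ n).continuous.aestronglyMeasurable.mul hdiv.1) hdiv.norm
      (fun n => .of_forall fun x => ?_) (.of_forall fun x => ?_)
    · rw [norm_mul, Real.norm_of_nonneg φ.nonneg]
      exact mul_le_of_le_one_left (norm_nonneg _) φ.le_one
    · have h1 : Tendsto (fun n => c n • x) atTop (𝓝 0) := by simpa using hc.smul_const x
      have h2 := (φ.continuous.tendsto 0).comp h1
      rw [φ.one_of_mem_closedBall (by simp [φ])] at h2
      simpa [χ] using h2.mul_const (trJac F x)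
  have hbound : ∀ n x, ‖∑ i, fderiv ℝ (χ n) x (Pi.single i 1) * F x i‖
      ≤ c n * (C * ∑ i, |F x i|) := by
    intro n x
    rw [← mul_assoc, Finset.mul_sum]
    refine (norm_sum_le _ _).trans (Finset.sum_le_sum fun i _ => ?_)
    rw [norm_mul]
    exact mul_le_mul_of_nonneg_right (hdχ n x i) (norm_nonneg _)
  have hnonneg : ∀ x, 0 ≤ C * ∑ i, |F x i| := fun x => by positivity
  have hlim_right : Tendsto (fun n => ∫ x, ∑ i, fderiv ℝ (χ n) x (Pi.single i 1) * F x i) atTop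
      (𝓝 (∫ _ : Vec d, (0 : ℝ))) := by
    refine tendsto_integral_of_dominated_convergence (fun x => C * ∑ i, |F x i|)
      (fun n => ?_) ((integrable_finsetSum _ fun i _ => (hint i).abs).const_mul C)
      (fun n => .of_forall fun x => (hbound n x).trans
        (mul_le_of_le_one_left (hnonneg x) (hc1 n))) (.of_forall fun x => ?_)
    · refine Continuous.aestronglyMeasurable (continuous_finsetSum _ fun i _ => ?_)
      exact (((hχ n).continuous_fderiv one_ne_zero).clm_apply continuous_const).mul
        ((continuous_apply i).comp hF.continuous)
    · exact squeeze_zero_norm (fun n => hbound n x) (by simpa using hc.mul_const _)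
  simp only [fun n => integral_mul_trJac_eq_neg hF (hχ n) (hχs n)] at hlim_left
  simpa using tendsto_nhds_unique hlim_left hlim_right.neg

theorem contDiff_score {d : ℕ} {p : Vec d → ℝ} (hpos : ∀ x, 0 < p x) (hp : ContDiff ℝ 2 p) :
    ContDiff ℝ 1 (score p) :=
  contDiff_pi.2 fun _ => ((hp.log fun x => (hpos x).ne').fderiv_right
    (by norm_num [one_add_one_eq_two])).clm_apply contDiff_const

theorem trJac_smul {d : ℕ} {p : Vec d → ℝ} (hpos : ∀ x, 0 < p x) (hp : Differentiable ℝ p)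
    {s : Vec d → Vec d} (hs : Differentiable ℝ s) (x : Vec d) :
    trJac (fun y => p y • s y) x = p x * (∑ i, score p x i * s x i + trJac s x) := by
  simp only [trJac, score, mul_add, Finset.mul_sum, ← Finset.sum_add_distrib]
  refine Finset.sum_congr rfl fun i _ => ?_
  have hlog := fderiv.log (hp x) (hpos x).ne'
  have hmul := fderiv_fun_mul (hp x) (differentiable_pi.1 hs i x)
  simp only [Pi.smul_apply, smul_eq_mul]
  rw [hlog, hmul]
  simp only [add_apply, smul_apply, smul_eq_mul]
  have := (hpos x).ne'
  field_simp
  ring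

/-- Products of vector fields with square-integrable norms are integrable. -/
theorem integrable_sum_mul {d : ℕ} {P : Measure (Vec d)} {u v : Vec d → Vec d}
    (hu : Continuous u) (hv : Continuous v) (hu2 : Integrable (fun x => ∑ i, u x i ^ 2) P)
    (hv2 : Integrable (fun x => ∑ i, v x i ^ 2) P) :
    Integrable (fun x => ∑ i, u x i * v x i) P := by
  refine (hu2.add hv2).mono' (Continuous.aestronglyMeasurable (by fun_prop))
    (.of_forall fun x => ?_)
  rw [Pi.add_apply, ← Finset.sum_add_distrib]
  refine (norm_sum_le _ _).trans (Finset.sum_le_sum fun i _ => ?_)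
  rw [Real.norm_eq_abs, abs_le]
  constructor <;> nlinarith [sq_nonneg (u x i + v x i), sq_nonneg (u x i - v x i)]

theorem integrable_apply_of_sum_sq {d : ℕ} {P : Measure (Vec d)} [IsFiniteMeasure P]
    {u : Vec d → Vec d} (hu : Continuous u) (hu2 : Integrable (fun x => ∑ i, u x i ^ 2) P)
    (i : Fin d) : Integrable (fun x => u x i) P := by
  refine ((integrable_const (1 : ℝ)).add hu2).mono' (Continuous.aestronglyMeasurable (by fun_prop))
    (.of_forall fun x => ?_)
  have h : u x i ^ 2 ≤ ∑ j, u x j ^ 2 :=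
    Finset.single_le_sum (f := fun j => u x j ^ 2) (fun j _ => sq_nonneg _) (Finset.mem_univ i)
  rw [Pi.add_apply, Real.norm_eq_abs, abs_le]
  constructor <;> nlinarith [sq_nonneg (u x i + 1), sq_nonneg (u x i - 1)]

/-- Stein's identity `E_P[⟪∇ log p, s⟫ + tr ∇s] = 0`. -/
theorem integral_score_mul_add_trJac {d : ℕ} {P : Measure (Vec d)} [IsProbabilityMeasure P]
    {p : Vec d → ℝ} (hP : P = volume.withDensity fun x => ENNReal.ofReal (p x))
    (hp_pos : ∀ x, 0 < p x) (hp_smooth : ContDiff ℝ 2 p)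
    {s : Vec d → Vec d} (hs : ContDiff ℝ 1 s)
    (hint_p : Integrable (fun x => ∑ i, (score p x i) ^ 2) P)
    (hint_s : Integrable (fun x => ∑ i, (s x i) ^ 2) P)
    (hint_tr : Integrable (fun x => trJac s x) P) :
    ∫ x, (∑ i, score p x i * s x i + trJac s x) ∂P = 0 := by
  have hmeas : Measurable fun x => ENNReal.ofReal (p x) :=
    hp_smooth.continuous.measurable.ennreal_ofReal
  have hfin : ∀ᵐ x : Vec d, ENNReal.ofReal (p x) < ∞ := .of_forall fun _ => ENNReal.ofReal_lt_top
  have hvol : ∀ f : Vec d → ℝ, Integrable f P → Integrable fun x => p x * f x := by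
    intro f hf
    rw [hP, integrable_withDensity_iff_integrable_smul' hmeas hfin] at hf
    simpa only [ENNReal.toReal_ofReal (hp_pos _).le, smul_eq_mul] using hf
  have hdiv : trJac (fun y => p y • s y)
      = fun x => p x * (∑ i, score p x i * s x i + trJac s x) :=
    funext fun x => trJac_smul hp_pos (hp_smooth.differentiable two_ne_zero)
      (hs.differentiable one_ne_zero) x
  have hzero := integral_trJac_eq_zero (F := fun y => p y • s y)
    ((hp_smooth.of_le one_le_two).smul hs)
    (fun i => hvol _ (integrable_apply_of_sum_sq hs.continuous hint_s i))
    (hdiv ▸ hvol _ ((integrable_sum_mul (contDiff_score hp_pos hp_smooth).continuous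
      hs.continuous hint_p hint_s).add hint_tr))
  rw [hdiv] at hzero
  rw [hP, integral_withDensity_eq_integral_toReal_smul hmeas hfin]
  simpa only [ENNReal.toReal_ofReal (hp_pos _).le, smul_eq_mul] using hzero

theorem integral_half_sum_sub_sq_score {d : ℕ} {P : Measure (Vec d)} [IsProbabilityMeasure P]
    {p : Vec d → ℝ} (hP : P = volume.withDensity fun x => ENNReal.ofReal (p x))
    (hp_pos : ∀ x, 0 < p x) (hp_smooth : ContDiff ℝ 2 p)
    {s : Vec d → Vec d} (hs : ContDiff ℝ 1 s)
    (hint_p : Integrable (fun x => ∑ i, (score p x i) ^ 2) P)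
    (hint_s : Integrable (fun x => ∑ i, (s x i) ^ 2) P)
    (hint_tr : Integrable (fun x => trJac s x) P) :
    ∫ x, (1/2) * ∑ i, (score p x i - s x i) ^ 2 ∂P
      = ∫ x, ((1/2) * ∑ i, (score p x i) ^ 2 + (1/2) * ∑ i, (s x i) ^ 2 + trJac s x) ∂P := by
  have hcross := integrable_sum_mul (contDiff_score hp_pos hp_smooth).continuous
    hs.continuous hint_p hint_s
  have hexpand : ∀ x, (1/2) * ∑ i, (score p x i - s x i) ^ 2
      = ((1/2) * ∑ i, (score p x i) ^ 2 + (1/2) * ∑ i, (s x i) ^ 2 + trJac s x)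
        - (∑ i, score p x i * s x i + trJac s x) := by
    intro x
    simp only [sub_sq, Finset.sum_add_distrib, Finset.sum_sub_distrib, mul_assoc,
      ← Finset.mul_sum]
    ring
  simp only [hexpand]
  rw [integral_sub (by fun_prop) (by fun_prop),
    integral_score_mul_add_trJac hP hp_pos hp_smooth hs hint_p hint_s hint_tr, sub_zero]

/-- Hyvärinen score `S_H(x, Q) = (1/2)‖∇log q(x)‖² + Δ_x log q(x)`. -/
def SH {d : ℕ} (q : Vec d → ℝ) (x : Vec d) : ℝ :=
  (1/2) * ∑ i, (score q x i) ^ 2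
    + ∑ i, fderiv ℝ (fun y => score q y i) x (Pi.single i 1)

/-- The filter of `‖X‖ → ∞`. -/
def atInfty (d : ℕ) : Filter (Vec d) := Filter.comap (fun x : Vec d => ‖x‖) Filter.atTop

/-- Hyvärinen's theorem (Lemma 1):
`E_P[(1/2)‖∇log p − s‖²] = E_P[(1/2)‖∇log p‖² + (1/2)‖s‖² + tr(∇s)]`; in particular,
for `s = ∇log q`, the Fisher divergence satisfies
`D_F(P‖Q) = E_P[(1/2)‖∇log p‖²] + E_P[S_H(X, Q)]`. -/
theorem statement0 {d : ℕ}
    (P : Measure (Vec d)) [IsProbabilityMeasure P]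
    (p : Vec d → ℝ)
    (hP : P = volume.withDensity fun x => ENNReal.ofReal (p x))
    (hp_pos : ∀ x, 0 < p x) (hp_smooth : ContDiff ℝ 2 p)
    (s : Vec d → Vec d) (hs : ContDiff ℝ 1 s)
    (hdecay_s : Tendsto (fun x => p x • s x) (atInfty d) (𝓝 0))
    (hdecay_p : Tendsto (fun x => p x • score p x) (atInfty d) (𝓝 0))
    (hint_p : Integrable (fun x => ∑ i, (score p x i) ^ 2) P)
    (hint_s : Integrable (fun x => ∑ i, (s x i) ^ 2) P)
    (hint_tr : Integrable (fun x => trJac s x) P)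
    (q : Vec d → ℝ) (hq_pos : ∀ x, 0 < q x) (hq_smooth : ContDiff ℝ 2 q)
    (hdecay_q : Tendsto (fun x => p x • score q x) (atInfty d) (𝓝 0))
    (hint_q : Integrable (fun x => ∑ i, (score q x i) ^ 2) P)
    (hint_trq : Integrable (fun x => trJac (score q) x) P) :
    (∫ x, (1/2) * ∑ i, (score p x i - s x i) ^ 2 ∂P
        = ∫ x, ((1/2) * ∑ i, (score p x i) ^ 2 + (1/2) * ∑ i, (s x i) ^ 2
            + trJac s x) ∂P)
    ∧ (∫ x, (1/2) * ∑ i, (score p x i - score q x i) ^ 2 ∂P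
        = (∫ x, (1/2) * ∑ i, (score p x i) ^ 2 ∂P) + ∫ x, SH q x ∂P) := by
  refine ⟨integral_half_sum_sub_sq_score hP hp_pos hp_smooth hs hint_p hint_s hint_tr, ?_⟩
  rw [integral_half_sum_sub_sq_score hP hp_pos hp_smooth (contDiff_score hq_pos hq_smooth)
    hint_p hint_q hint_trq]
  simp only [add_assoc]
  exact integral_add (hint_p.const_mul _) ((hint_q.const_mul _).add hint_trq)
end
end

section
/- Fix ᾱ ∈ (0,1). Suppose m : ℝ^d → ℝ^{d×w} satisfies the regularity assumptions, Z_m is P∞-integrable with E_{X∼P∞}[Z_m(X)] = −D_m(P∞‖P1) < 0, and E_{X∼P1}[exp(−Z_m(X))] = 1. Then there exists a sequence of thresholds (c_n) such that the diffusion hypothesis tests T_m^{c_n} satisfy limsup_{n→∞} α_n(T_m^{c_n}) ≤ ᾱ and the type II error exponent satisfies −limsup_{n→∞} (log β_n(T_m^{c_n}))/n ≥ D_m(P∞‖P1). -/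
open MeasureTheory ProbabilityTheory Filter Topology
open scoped ENNReal

noncomputable section

/-- `m(x)ᵀ v` for a matrix-valued function `m : ℝ^d → ℝ^{d×w}`. -/
def mT {d w : ℕ} (m : Vec d → Fin d → Fin w → ℝ) (x : Vec d) (v : Vec d) : Fin w → ℝ :=
  fun j => ∑ i, m x i j * v i

/-- `m(x) u` for `u ∈ ℝ^w`. -/
def mV {d w : ℕ} (m : Vec d → Fin d → Fin w → ℝ) (x : Vec d) (u : Fin w → ℝ) : Vec d :=
  fun i => ∑ j, m x i j * u j

/-- Divergence `∇ ⬝ f` of a vector field. -/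
def divg {d : ℕ} (f : Vec d → Vec d) (x : Vec d) : ℝ :=
  ∑ i, fderiv ℝ (fun y => f y i) x (Pi.single i 1)

/-- Diffusion-Hyvärinen score
`S_m(x, P) = (1/2) ‖m(x)ᵀ ∇log p(x)‖² + ∇ ⬝ (m(x) m(x)ᵀ ∇ log p(x))`. -/
def Sm {d w : ℕ} (m : Vec d → Fin d → Fin w → ℝ) (p : Vec d → ℝ) (x : Vec d) : ℝ :=
  (1/2) * ∑ j, (mT m x (score p x) j) ^ 2
    + divg (fun y => mV m y (mT m y (score p y))) x

/-- Diffusion test statistic / instantaneous detection score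
`Z_m(x) = S_m(x, P∞) - S_m(x, P1)`. -/
def Zstat {d w : ℕ} (m : Vec d → Fin d → Fin w → ℝ) (pinf pone : Vec d → ℝ) (x : Vec d) : ℝ :=
  Sm m pinf x - Sm m pone x

/-- Diffusion divergence `D_m(P‖Q) = E_{X∼P}[(1/2)‖m(X)ᵀ(∇log p(X) − ∇log q(X))‖²]`,
where `p`, `q` are the densities of `P`, `Q`. -/
def Dm {d w : ℕ} (P : Measure (Vec d)) (m : Vec d → Fin d → Fin w → ℝ)
    (p q : Vec d → ℝ) : ℝ :=
  ∫ x, (1/2) * ∑ j, (mT m x (fun i => score p x i - score q x i) j) ^ 2 ∂P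

/-- Regularity assumptions for the ordered pair `(R, S)` (with densities `r`, `s`):
`∇ log s` is continuously differentiable, `E_R[‖m(X)ᵀ∇log s(X)‖²] < ∞`,
`E_R[‖m(X)ᵀ∇log r(X)‖²] < ∞`, and `s(X) m(X)m(X)ᵀ ∇log r(X) → 0` as `‖X‖ → ∞`. -/
def Reg {d w : ℕ} (R : Measure (Vec d)) (r s : Vec d → ℝ)
    (m : Vec d → Fin d → Fin w → ℝ) : Prop :=
  ContDiff ℝ 1 (fun x => score s x)
  ∧ Integrable (fun x => ∑ j, (mT m x (score s x) j) ^ 2) R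
  ∧ Integrable (fun x => ∑ j, (mT m x (score r x) j) ^ 2) R
  ∧ Tendsto (fun x => (fun i => s x * mV m x (mT m x (score r x)) i : Vec d))
      (atInfty d) (𝓝 0)

/-- The joint law of finitely many coordinates of an i.i.d. sequence is the product measure. -/
theorem iid_measurePreserving_pi {Ω X : Type*} [MeasurableSpace Ω] [MeasurableSpace X]
    {μ : Measure Ω} [IsProbabilityMeasure μ] {P : Measure X} {Y : ℕ → Ω → X}
    (hmeas : ∀ i, Measurable (Y i)) (hlaw : ∀ i, HasLaw (Y i) P μ) (hind : iIndepFun Y μ)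
    (n : ℕ) :
    MeasurePreserving (fun ω (i : Fin n) => Y i ω) μ (Measure.pi fun _ : Fin n => P) := by
  refine ⟨measurable_pi_lambda _ fun i => hmeas i, ?_⟩
  have h := hind.precomp (g := fun i : Fin n => (i : ℕ)) Fin.val_injective
  rw [(iIndepFun_iff_map_fun_eq_pi_map fun i : Fin n => (hmeas i).aemeasurable).1 h]
  simp only [(hlaw _).map_eq]

/-- Weak law of large numbers with a deterministic margin vanishing as `n → ∞`. -/
theorem exists_margin_upper_tail_tendsto_zero {X : Type*} [MeasurableSpace X]
    (P : Measure X) [IsProbabilityMeasure P] {Z : X → ℝ} (hZ : Measurable Z)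
    (hint : Integrable Z P) :
    ∃ ε : ℕ → ℝ, (∀ n, 0 < ε n) ∧ Tendsto ε atTop (𝓝 0) ∧
      Tendsto (fun n : ℕ => (Measure.pi fun _ : Fin n => P).real
        {ω | n * (∫ x, Z x ∂P + ε n) ≤ ∑ i, Z (ω i)}) atTop (𝓝 0) := by
  obtain ⟨Ω, _, μ, Y, hmeas, hlaw, hind, _⟩ := exists_iid ℕ P
  have hident (i : ℕ) : IdentDistrib (Y i) (Y 0) μ μ :=
    ⟨(hmeas i).aemeasurable, (hmeas 0).aemeasurable, by rw [(hlaw i).map_eq, (hlaw 0).map_eq]⟩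
  have hYint (i : ℕ) : Integrable (fun ω => Z (Y i ω)) μ := by
    refine (MeasurePreserving.mk (hmeas i) (hlaw i).map_eq).integrable_comp_of_integrable hint
  have hmean : ∫ ω, Z (Y 0 ω) ∂μ = ∫ x, Z x ∂P := by
    rw [← (hlaw 0).map_eq, integral_map (hmeas 0).aemeasurable hZ.aestronglyMeasurable]
  have hlln := strong_law_Lp le_rfl ENNReal.one_ne_top (fun i ω => Z (Y i ω))
    (memLp_one_iff_integrable.2 (hYint 0))
    (fun i j hij => (hind.indepFun hij).comp hZ hZ) (fun i => (hident i).comp hZ)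
  simp only [hmean, smul_eq_mul] at hlln
  set f : ℕ → Ω → ℝ := fun n ω =>
    (n : ℝ)⁻¹ * (∑ i ∈ Finset.range n, Z (Y i ω)) - ∫ x, Z x ∂P with hf
  have hfint (n : ℕ) : Integrable (f n) μ :=
    ((integrable_finsetSum _ fun i _ => hYint i).const_mul _).sub (integrable_const _)
  have hr : Tendsto (fun n => ∫ ω, ‖f n ω‖ ∂μ) atTop (𝓝 0) := by
    refine ((ENNReal.tendsto_toReal ENNReal.zero_ne_top).comp hlln).congr fun n => ?_
    simp only [Function.comp_apply]
    rw [integral_norm_eq_lintegral_enorm (hfint n).1, eLpNorm_one_eq_lintegral_enorm]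
  set s : ℕ → ℝ := fun n => √(∫ ω, ‖f n ω‖ ∂μ)
  have hs0 : Tendsto s atTop (𝓝 0) := by
    rw [← Real.sqrt_zero]
    exact hr.sqrt
  have hεpos (n : ℕ) : 0 < s n + 1 / ((n : ℝ) + 1) := by positivity
  refine ⟨fun n => s n + 1 / ((n : ℝ) + 1), hεpos, ?_, ?_⟩
  · simpa using hs0.add tendsto_one_div_add_atTop_nhds_zero_nat
  refine squeeze_zero' (Eventually.of_forall fun n => measureReal_nonneg) ?_ hs0
  filter_upwards [eventually_gt_atTop 0] with n hn
  have hn' : (0 : ℝ) < n := by exact_mod_cast hn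
  set e := s n + 1 / ((n : ℝ) + 1) with he
  have hset : MeasurableSet {ω : Fin n → X | n * (∫ x, Z x ∂P + e) ≤ ∑ i, Z (ω i)} :=
    measurableSet_le measurable_const (by fun_prop)
  rw [← (iid_measurePreserving_pi hmeas hlaw hind n).measureReal_preimage hset.nullMeasurableSet]
  have hsub : (fun ω (i : Fin n) => Y i ω) ⁻¹'
      {ω : Fin n → X | n * (∫ x, Z x ∂P + e) ≤ ∑ i, Z (ω i)} ⊆ {ω | e ≤ ‖f n ω‖} := by
    intro ω hω
    simp only [Set.mem_preimage, Set.mem_ofPred_eq] at hω ⊢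
    rw [Fin.sum_univ_eq_sum_range (fun i => Z (Y i ω)) n] at hω
    refine le_trans ?_ (le_abs_self _)
    rw [hf, le_sub_iff_add_le, add_comm, inv_mul_eq_div, le_div_iff₀ hn', mul_comm]
    exact hω
  refine (measureReal_mono hsub).trans ?_
  have hmarkov := mul_meas_ge_le_integral_of_nonneg (μ := μ) (f := fun ω => ‖f n ω‖)
    (Eventually.of_forall fun ω => norm_nonneg _) (hfint n).norm e
  have hsq : s n * s n = ∫ ω, ‖f n ω‖ ∂μ :=
    Real.mul_self_sqrt (integral_nonneg fun ω => norm_nonneg _)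
  have hse : s n ≤ e := by rw [he]; linarith [show 0 < 1 / ((n : ℝ) + 1) by positivity]
  refine le_of_mul_le_mul_left (hmarkov.trans ?_) (hεpos n)
  rw [← hsq]
  exact mul_le_mul_of_nonneg_right hse (Real.sqrt_nonneg _)

/-- Chernoff bound for the lower tail of a sum of i.i.d. terms with `E[exp (-Z)] = 1`. -/
theorem pi_real_sum_lt_le_exp {ι X : Type*} [Fintype ι] [MeasurableSpace X]
    (Q : Measure X) [IsProbabilityMeasure Q] {Z : X → ℝ}
    (hexp : ∫ x, Real.exp (-(Z x)) ∂Q = 1) (c : ℝ) :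
    (Measure.pi fun _ : ι => Q).real {ω | ∑ i, Z (ω i) < c} ≤ Real.exp c := by
  have hint : Integrable (fun x => Real.exp (-(Z x))) Q :=
    .of_integral_ne_zero (by rw [hexp]; exact one_ne_zero)
  have hprod (ω : ι → X) :
      Real.exp (-1 * ∑ i, Z (ω i)) = ∏ i, Real.exp (-(Z (ω i))) := by
    rw [neg_one_mul, ← Finset.sum_neg_distrib, Real.exp_sum]
  have hI : Integrable (fun ω : ι → X => Real.exp (-1 * ∑ i, Z (ω i)))
      (Measure.pi fun _ : ι => Q) := by
    simp only [hprod]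
    exact Integrable.fintype_prod fun _ => hint
  have hmgf : mgf (fun ω : ι → X => ∑ i, Z (ω i)) (Measure.pi fun _ : ι => Q) (-1) = 1 := by
    simp only [mgf, hprod]
    rw [integral_fintype_prod_eq_pow (fun x => Real.exp (-(Z x))), hexp, one_pow]
  have h := measure_le_le_exp_mul_mgf c (by norm_num) hI
  rw [hmgf, neg_neg, one_mul, mul_one] at h
  refine (measureReal_mono ?_).trans h
  exact fun ω hω => le_of_lt (show ∑ i, Z (ω i) < c from hω)

/-- If each of `n` i.i.d. terms is at most `a` with probability `q`, their sum is below any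
`c > n a` with probability at least `q ^ n`. -/
theorem pow_le_pi_real_sum_lt {X : Type*} [MeasurableSpace X]
    (Q : Measure X) [IsProbabilityMeasure Q] (Z : X → ℝ) {n : ℕ} {a c : ℝ} (hc : n * a < c) :
    Q.real {x | Z x ≤ a} ^ n ≤
      (Measure.pi fun _ : Fin n => Q).real {ω | ∑ i, Z (ω i) < c} := by
  have hpi : (Measure.pi fun _ : Fin n => Q).real (Set.univ.pi fun _ => {x | Z x ≤ a}) =
      Q.real {x | Z x ≤ a} ^ n := by
    simp [measureReal_def, Measure.pi_pi]
  rw [← hpi]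
  refine measureReal_mono fun ω hω => ?_
  have h : ∑ i, Z (ω i) ≤ ∑ _i : Fin n, a :=
    Finset.sum_le_sum fun i _ => hω i (Set.mem_univ i)
  simp only [Finset.sum_const, Finset.card_univ, Fintype.card_fin, nsmul_eq_mul] at h
  exact h.trans_lt hc

/-- The likelihood-ratio-free analogue of Stein's lemma: if `P ≪ Q` and `E_Q[exp (-Z)] = 1`,
some thresholds make the type I error vanish with type II error exponent at least `-E_P[Z]`. -/
theorem exists_threshold_exponent {X : Type*} [MeasurableSpace X]
    (P Q : Measure X) [IsProbabilityMeasure P] [IsProbabilityMeasure Q] (hPQ : P ≪ Q)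
    {Z : X → ℝ} (hZ : Measurable Z) (hint : Integrable Z P)
    (hexp : ∫ x, Real.exp (-(Z x)) ∂Q = 1) :
    ∃ c : ℕ → ℝ,
      Tendsto (fun n : ℕ => (Measure.pi fun _ : Fin n => P).real
        {ω | c n ≤ ∑ i, Z (ω i)}) atTop (𝓝 0) ∧
      limsup (fun n : ℕ => Real.log ((Measure.pi fun _ : Fin n => Q).real
        {ω | ∑ i, Z (ω i) < c n}) / n) atTop ≤ ∫ x, Z x ∂P := by
  obtain ⟨ε, hεpos, hε, hα⟩ := exists_margin_upper_tail_tendsto_zero P hZ hint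
  refine ⟨fun n => n * (∫ x, Z x ∂P + ε n), hα, ?_⟩
  set a := ∫ x, Z x ∂P
  have hq : 0 < Q.real {x | Z x ≤ a} := by
    refine ENNReal.toReal_pos (fun h => ?_) (measure_ne_top _ _)
    exact (measure_le_integral_pos hint).ne' (hPQ h)
  have hlower : ∀ᶠ n : ℕ in atTop, Real.log (Q.real {x | Z x ≤ a}) ≤
      Real.log ((Measure.pi fun _ : Fin n => Q).real
        {ω | ∑ i, Z (ω i) < n * (a + ε n)}) / n := by
    filter_upwards [eventually_gt_atTop 0] with n hn
    have hn' : (0 : ℝ) < n := by exact_mod_cast hn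
    rw [le_div_iff₀ hn', mul_comm, ← Real.log_pow]
    refine Real.log_le_log (pow_pos hq n) (pow_le_pi_real_sum_lt Q Z ?_)
    exact mul_lt_mul_of_pos_left (lt_add_of_pos_right a (hεpos n)) hn'
  have hupper : ∀ᶠ n : ℕ in atTop,
      Real.log ((Measure.pi fun _ : Fin n => Q).real
        {ω | ∑ i, Z (ω i) < n * (a + ε n)}) / n ≤ a + ε n := by
    filter_upwards [eventually_gt_atTop 0] with n hn
    have hn' : (0 : ℝ) < n := by exact_mod_cast hn
    rw [div_le_iff₀' hn']
    refine (Real.log_le_iff_le_exp ?_).2 (pi_real_sum_lt_le_exp Q hexp _)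
    refine (pow_pos hq n).trans_le (pow_le_pi_real_sum_lt Q Z ?_)
    exact mul_lt_mul_of_pos_left (lt_add_of_pos_right a (hεpos n)) hn'
  have hlim : Tendsto (fun n => a + ε n) atTop (𝓝 a) := by simpa using hε.const_add a
  refine (limsup_le_limsup hupper ?_ hlim.isBoundedUnder_le).trans hlim.limsup_eq.le
  exact IsCoboundedUnder.of_frequently_ge hlower.frequently

theorem measurable_score {d : ℕ} (p : Vec d → ℝ) : Measurable (score p) :=
  measurable_pi_lambda _ fun _ => measurable_fderiv_apply_const ℝ _ _

theorem measurable_Sm {d w : ℕ} {m : Vec d → Fin d → Fin w → ℝ} (hm : Measurable m)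
    (p : Vec d → ℝ) : Measurable (Sm m p) := by
  have hs := measurable_score p
  have hdiv : Measurable (divg fun y => mV m y (mT m y (score p y))) :=
    Finset.measurable_sum _ fun _ _ => measurable_fderiv_apply_const ℝ _ _
  have hquad : Measurable fun x => ∑ j, (mT m x (score p x) j) ^ 2 := by
    unfold mT
    fun_prop
  exact (hquad.const_mul _).add hdiv

theorem withDensity_ofReal_absolutelyContinuous {X : Type*} [MeasurableSpace X]
    (μ : Measure X) (p : X → ℝ) {q : X → ℝ} (hq : Measurable q) (hpos : ∀ x, 0 < q x) :
    (μ.withDensity fun x => ENNReal.ofReal (p x)) ≪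
      μ.withDensity fun x => ENNReal.ofReal (q x) :=
  (withDensity_absolutelyContinuous μ _).trans <|
    withDensity_absolutelyContinuous' hq.ennreal_ofReal.aemeasurable
      (ae_of_all _ fun x => (ENNReal.ofReal_pos.2 (hpos x)).ne')

/-- Error exponent of the diffusion hypothesis test (Theorem 1): if
`E_{P1}[exp(−Z_m)] = 1` then there are thresholds `c_n` with
`limsup α_n ≤ ᾱ` and type II error exponent at least `D_m(P∞‖P1)`. -/
theorem statement5 {d w : ℕ}
    (Pinf Pone : Measure (Vec d)) [IsProbabilityMeasure Pinf] [IsProbabilityMeasure Pone]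
    (pinf pone : Vec d → ℝ)
    (hPinf : Pinf = volume.withDensity fun x => ENNReal.ofReal (pinf x))
    (hPone : Pone = volume.withDensity fun x => ENNReal.ofReal (pone x))
    (hne : Pinf ≠ Pone)
    (hpinf_pos : ∀ x, 0 < pinf x) (hpone_pos : ∀ x, 0 < pone x)
    (hpinf_smooth : ContDiff ℝ 2 pinf) (hpone_smooth : ContDiff ℝ 2 pone)
    (m : Vec d → Fin d → Fin w → ℝ) (hm : ContDiff ℝ 1 m)
    (hreg1 : Reg Pinf pinf pone m) (hreg2 : Reg Pone pone pinf m)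
    (abar : ℝ) (habar : abar ∈ Set.Ioo (0 : ℝ) 1)
    (hint : Integrable (Zstat m pinf pone) Pinf)
    (hDpos : 0 < Dm Pinf m pinf pone)
    (hmean : ∫ x, Zstat m pinf pone x ∂Pinf = - Dm Pinf m pinf pone)
    (hexp : ∫ x, Real.exp (-(Zstat m pinf pone x)) ∂Pone = 1) :
    ∃ c : ℕ → ℝ,
      Filter.limsup (fun n : ℕ =>
          ((Measure.pi fun _ : Fin n => Pinf)
            {ω : Fin n → Vec d | c n ≤ ∑ i, Zstat m pinf pone (ω i)}).toReal) atTop ≤ abar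
      ∧ Dm Pinf m pinf pone
          ≤ - Filter.limsup (fun n : ℕ =>
              Real.log (((Measure.pi fun _ : Fin n => Pone)
                {ω : Fin n → Vec d | ∑ i, Zstat m pinf pone (ω i) < c n}).toReal) / n)
              atTop := by
  have hac : Pinf ≪ Pone := by
    rw [hPinf, hPone]
    exact withDensity_ofReal_absolutelyContinuous volume pinf
      hpone_smooth.continuous.measurable hpone_pos
  have hZ : Measurable (Zstat m pinf pone) :=
    (measurable_Sm hm.continuous.measurable pinf).sub
      (measurable_Sm hm.continuous.measurable pone)
  obtain ⟨c, hα, hβ⟩ := exists_threshold_exponent Pinf Pone hac hZ hint hexp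
  refine ⟨c, hα.limsup_eq.trans_le habar.1.le, ?_⟩
  rw [hmean] at hβ
  exact le_neg_of_le_neg hβ
end
end

section
/- Suppose m : ℝ^d → ℝ^{d×w} satisfies the regularity assumptions, D_m(P∞‖P1) > 0 and D_m(P1‖P∞) > 0, Z_m is P∞-integrable with E_{X∼P∞}[Z_m(X)] = −D_m(P∞‖P1), and E_{X∼P∞}[exp Z_m(X)] ≤ 1. Then, with δ = −log E_{X∼P∞}[exp Z_m(X)] ≥ 0, the shifted drift is strictly negative: E_{X∼P∞}[Z_m(X)] + δ < 0; equivalently, the strict Jensen inequality D_m(P∞‖P1) = −E_{X∼P∞}[Z_m(X)] > −log E_{X∼P∞}[exp Z_m(X)] holds. -/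
open MeasureTheory ProbabilityTheory Filter Topology
open scoped ENNReal

noncomputable section

lemma fderiv_eq_mul_score {d : ℕ} {p : Vec d → ℝ} {x : Vec d} (hp : DifferentiableAt ℝ p x)
    (hpos : 0 < p x) (i : Fin d) : fderiv ℝ p x (Pi.single i 1) = p x * score p x i := by
  simp only [score]
  rw [fderiv.log hp hpos.ne']
  simp [mul_inv_cancel_left₀ hpos.ne']

lemma divg_mul {d : ℕ} {f : Vec d → ℝ} {G : Vec d → Vec d} {x : Vec d}
    (hf : DifferentiableAt ℝ f x) (hG : DifferentiableAt ℝ G x) :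
    divg (fun y i => f y * G y i) x
      = f x * divg G x + ∑ i, fderiv ℝ f x (Pi.single i 1) * G x i := by
  simp only [divg, Finset.mul_sum, ← Finset.sum_add_distrib]
  refine Finset.sum_congr rfl fun i _ => ?_
  rw [fderiv_fun_mul hf (differentiableAt_pi.1 hG i)]
  simp [mul_comm]

lemma divg_sub {d : ℕ} {F G : Vec d → Vec d} {x : Vec d}
    (hF : DifferentiableAt ℝ F x) (hG : DifferentiableAt ℝ G x) :
    divg (fun y i => F y i - G y i) x = divg F x - divg G x := by
  simp only [divg, ← Finset.sum_sub_distrib]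
  refine Finset.sum_congr rfl fun i _ => ?_
  rw [fderiv_fun_sub (differentiableAt_pi.1 hF i) (differentiableAt_pi.1 hG i)]
  simp

lemma continuous_fderiv_single {d : ℕ} {f : Vec d → ℝ} (hf : ContDiff ℝ 1 f) (i : Fin d) :
    Continuous fun x => fderiv ℝ f x (Pi.single i 1) :=
  (hf.continuous_fderiv one_ne_zero).clm_apply continuous_const

lemma continuous_divg {d : ℕ} {F : Vec d → Vec d} (hF : ContDiff ℝ 1 F) :
    Continuous (divg F) :=
  continuous_finsetSum _ fun i _ => continuous_fderiv_single (contDiff_pi.1 hF i) i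

lemma integral_divg_eq_zero_of_hasCompactSupport {d : ℕ} {F : Vec d → Vec d}
    (hF : ContDiff ℝ 1 F) (hc : HasCompactSupport F) : ∫ x, divg F x = 0 := by
  have hFi : ∀ i, ContDiff ℝ 1 fun x => F x i := contDiff_pi.1 hF
  have hci : ∀ i, HasCompactSupport fun x => F x i := fun i =>
    hc.comp_left (g := fun v : Vec d => v i) rfl
  have hint : ∀ i, Integrable fun x => fderiv ℝ (fun y => F y i) x (Pi.single i 1) := fun i =>
    (continuous_fderiv_single (hFi i) i).integrable_of_hasCompactSupport
      ((hci i).fderiv_apply ℝ _)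
  simp only [divg]
  rw [integral_finsetSum _ fun i _ => hint i]
  refine Finset.sum_eq_zero fun i _ => ?_
  have := integral_mul_fderiv_eq_neg_fderiv_mul_of_integrable (μ := (volume : Measure (Vec d)))
    (f := fun _ => (1 : ℝ)) (g := fun x => F x i) (v := Pi.single i 1) (by simp)
    (by simpa using hint i)
    (by simpa using (hFi i).continuous.integrable_of_hasCompactSupport (hci i))
    (fun x _ => differentiableAt_const _)
    (fun x _ => (hFi i).differentiable one_ne_zero x)
  simpa using this

/-- If cutoffs `χ n → 1` have gradients of size `O(1 / n)` against `F` and each `χ n • F` has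
vanishing total divergence, then so does `F`. -/
lemma integral_divg_eq_zero_of_cutoff {d : ℕ} {F : Vec d → Vec d} (hF : ContDiff ℝ 1 F)
    (hdiv : Integrable (divg F)) {χ : ℕ → Vec d → ℝ} (hχ : ∀ n, ContDiff ℝ 1 (χ n))
    (hχ_le : ∀ n x, |χ n x| ≤ 1) (hχ_lim : ∀ x, Tendsto (fun n => χ n x) atTop (𝓝 1))
    {H : Vec d → ℝ} (hH : Integrable H)
    (hgrad : ∀ n x, |∑ i, fderiv ℝ (χ n) x (Pi.single i 1) * F x i| ≤ H x / (n + 1))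
    (hzero : ∀ n, Integrable (divg fun y i => χ n y * F y i) →
      ∫ x, divg (fun y i => χ n y * F y i) x = 0) :
    ∫ x, divg F x = 0 := by
  have hformula : ∀ n x, divg (fun y i => χ n y * F y i) x
      = χ n x * divg F x + ∑ i, fderiv ℝ (χ n) x (Pi.single i 1) * F x i := fun n x =>
    divg_mul ((hχ n).differentiable one_ne_zero x) (hF.differentiable one_ne_zero x)
  have hmeas : ∀ n, AEStronglyMeasurable (divg fun y i => χ n y * F y i) volume := fun n =>
    (continuous_divg (contDiff_pi.2 fun i => (hχ n).mul (contDiff_pi.1 hF i))).aestronglyMeasurable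
  have hbound : ∀ n x, ‖divg (fun y i => χ n y * F y i) x‖ ≤ |divg F x| + H x := by
    intro n x
    have hn : (0 : ℝ) < n + 1 := by positivity
    have hH0 : 0 ≤ H x := by
      have := (abs_nonneg _).trans (hgrad n x)
      rwa [le_div_iff₀ hn, zero_mul] at this
    rw [hformula, Real.norm_eq_abs]
    refine (abs_add_le _ _).trans (add_le_add ?_ ((hgrad n x).trans ?_))
    · rw [abs_mul]
      exact mul_le_of_le_one_left (abs_nonneg _) (hχ_le n x)
    · exact div_le_self hH0 (by simp)
  have hdom : Integrable fun x => |divg F x| + H x := hdiv.abs.add hH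
  have hlim : ∀ x, Tendsto (fun n => divg (fun y i => χ n y * F y i) x) atTop
      (𝓝 (divg F x)) := by
    intro x
    simp only [hformula]
    have h1 : Tendsto (fun n : ℕ => H x / ((n : ℝ) + 1)) atTop (𝓝 0) :=
      tendsto_const_nhds.div_atTop
        (tendsto_atTop_add_const_right _ _ tendsto_natCast_atTop_atTop)
    simpa using ((hχ_lim x).mul_const (divg F x)).add
      (squeeze_zero_norm (fun n => hgrad n x) h1)
  have key := tendsto_integral_of_dominated_convergence _ hmeas hdom
    (fun n => ae_of_all _ (hbound n)) (ae_of_all _ hlim)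
  refine tendsto_nhds_unique key ?_
  simp only [fun n => hzero n (hdom.mono' (hmeas n) (ae_of_all _ (hbound n)))]
  exact tendsto_const_nhds

lemma eventually_bump_div_eq_one (η : ContDiffBump (0 : ℝ)) (t : ℝ) :
    ∀ᶠ n : ℕ in atTop, η (t / (n + 1)) = 1 := by
  have h1 : Tendsto (fun n : ℕ => t / ((n : ℝ) + 1)) atTop (𝓝 0) :=
    tendsto_const_nhds.div_atTop
      (tendsto_atTop_add_const_right _ _ tendsto_natCast_atTop_atTop)
  exact h1.eventually η.eventuallyEq_one

/-- The divergence theorem for integrable vector fields with integrable divergence. -/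
lemma integral_divg_eq_zero {d : ℕ} {F : Vec d → Vec d} (hF : ContDiff ℝ 1 F)
    (hint : ∀ i, Integrable fun x => F x i) (hdiv : Integrable (divg F)) :
    ∫ x, divg F x = 0 := by
  let ψ : ContDiffBump (0 : Vec d) := ⟨1, 2, one_pos, one_lt_two⟩
  have hψ : ContDiff ℝ 1 ψ := ψ.contDiff
  obtain ⟨C, hC⟩ : ∃ C, ∀ x, ‖fderiv ℝ ψ x‖ ≤ C :=
    (hψ.continuous_fderiv one_ne_zero).bounded_above_of_compact_support
      (ψ.hasCompactSupport.fderiv ℝ)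
  have hC0 : 0 ≤ C := (norm_nonneg _).trans (hC 0)
  have hscale : ∀ n : ℕ, ((n : ℝ) + 1)⁻¹ ≠ 0 := fun n => by positivity
  refine integral_divg_eq_zero_of_cutoff hF hdiv (χ := fun n x => ψ (((n : ℝ) + 1)⁻¹ • x))
    (fun n => hψ.comp (contDiff_const_smul _))
    (fun n x => by rw [abs_of_nonneg ψ.nonneg]; exact ψ.le_one) ?_
    (H := fun x => ∑ i, C * |F x i|)
    (integrable_finsetSum _ fun i _ => (hint i).abs.const_mul C) ?_ ?_
  · intro x
    have h1 : Tendsto (fun n : ℕ => ((n : ℝ) + 1)⁻¹) atTop (𝓝 0) :=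
      tendsto_inv_atTop_zero.comp
        (tendsto_atTop_add_const_right _ _ tendsto_natCast_atTop_atTop)
    have h2 : Tendsto (fun n : ℕ => ((n : ℝ) + 1)⁻¹ • x) atTop (𝓝 0) := by
      simpa using h1.smul_const x
    exact tendsto_const_nhds.congr' (EventuallyEq.symm (h2.eventually ψ.eventuallyEq_one))
  · intro n x
    rw [Finset.sum_div]
    refine (Finset.abs_sum_le_sum_abs _ _).trans (Finset.sum_le_sum fun i _ => ?_)
    have hn : (0 : ℝ) < ((n : ℝ) + 1)⁻¹ := by positivity
    have h1 : |fderiv ℝ ψ (((n : ℝ) + 1)⁻¹ • x) (Pi.single i 1)| ≤ C := by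
      refine ((fderiv ℝ ψ _).le_opNorm _).trans ?_
      simpa [Pi.norm_single] using hC (((n : ℝ) + 1)⁻¹ • x)
    rw [fderiv_comp_smul]
    simp only [smul_apply, smul_eq_mul, abs_mul, abs_of_pos hn]
    rw [div_eq_inv_mul, mul_assoc]
    gcongr
  · intro n _
    refine integral_divg_eq_zero_of_hasCompactSupport
      (contDiff_pi.2 fun i => (hψ.comp (contDiff_const_smul _)).mul (contDiff_pi.1 hF i)) ?_
    have h := ψ.hasCompactSupport.comp_smul (hscale n)
    exact h.smul_right (f' := F)

lemma exists_norm_le_of_tendsto_atInfty {d : ℕ} {f : Vec d → Vec d} (hf : Continuous f)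
    (hlim : Tendsto f (atInfty d) (𝓝 0)) : ∃ C, ∀ x, ‖f x‖ ≤ C := by
  rw [atInfty, comap_norm_atTop, Metric.cobounded_eq_cocompact] at hlim
  have h1 : ∀ᶠ x in cocompact (Vec d), ‖f x‖ < 1 := by
    exact hlim.norm.eventually_lt_const (by simp)
  obtain ⟨K, hK, hKc⟩ := mem_cocompact.1 h1
  obtain ⟨C, hC⟩ := hK.exists_bound_of_continuousOn hf.continuousOn
  refine ⟨max C 1, fun x => ?_⟩
  by_cases hx : x ∈ K
  · exact (hC x hx).trans (le_max_left _ _)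
  · exact (hKc hx).le.trans (le_max_right _ _)

lemma sum_mul_mV_mT {d w : ℕ} (m : Vec d → Fin d → Fin w → ℝ) (x v u : Vec d) :
    ∑ i, v i * mV m x (mT m x u) i = ∑ j, mT m x v j * mT m x u j := by
  simp only [mV, Finset.mul_sum]
  rw [Finset.sum_comm]
  refine Finset.sum_congr rfl fun j _ => ?_
  generalize mT m x u j = t
  rw [mT, Finset.sum_mul]
  exact Finset.sum_congr rfl fun i _ => by ring

lemma mT_sub {d w : ℕ} (m : Vec d → Fin d → Fin w → ℝ) (x a b : Vec d) (j : Fin w) :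
    mT m x (fun i => a i - b i) j = mT m x a j - mT m x b j := by
  simp [mT, mul_sub, Finset.sum_sub_distrib]

lemma mV_mT_sub {d w : ℕ} (m : Vec d → Fin d → Fin w → ℝ) (x a b : Vec d) (i : Fin d) :
    mV m x (mT m x fun i => a i - b i) i = mV m x (mT m x a) i - mV m x (mT m x b) i := by
  simp [mV, mT_sub, mul_sub, Finset.sum_sub_distrib]

lemma contDiff_mV_mT {d w : ℕ} {m : Vec d → Fin d → Fin w → ℝ} (hm : ContDiff ℝ 1 m)
    {v : Vec d → Vec d} (hv : ContDiff ℝ 1 v) :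
    ContDiff ℝ 1 fun x => mV m x (mT m x (v x)) := by
  have hmij : ∀ i j, ContDiff ℝ 1 fun x => m x i j := fun i j =>
    contDiff_pi.1 (contDiff_pi.1 hm i) j
  exact contDiff_pi.2 fun i => ContDiff.sum fun j _ => (hmij i j).mul
    (ContDiff.sum fun k _ => (hmij k j).mul (contDiff_pi.1 hv k))

lemma abs_sum_mul_mV_mT_sub_le {d w : ℕ} (m : Vec d → Fin d → Fin w → ℝ) (x v a b : Vec d)
    (hv : v = a ∨ v = b) :
    |∑ i, v i * mV m x (mT m x fun i => a i - b i) i|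
      ≤ 2 * (∑ j, mT m x a j ^ 2 + ∑ j, mT m x b j ^ 2) := by
  rw [sum_mul_mV_mT, ← Finset.sum_add_distrib, Finset.mul_sum]
  refine (Finset.abs_sum_le_sum_abs _ _).trans (Finset.sum_le_sum fun j _ => ?_)
  rw [mT_sub, abs_le]
  have hvj : mT m x v j = mT m x a j ∨ mT m x v j = mT m x b j := by
    rcases hv with rfl | rfl <;> simp
  rcases hvj with h | h <;> rw [h] <;> constructor <;>
    nlinarith [sq_nonneg (mT m x a j - mT m x b j), sq_nonneg (mT m x a j + mT m x b j),
      sq_nonneg (mT m x a j), sq_nonneg (mT m x b j)]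

/-- The vector field `p m mᵀ (∇ log q - ∇ log p)`. -/
def scoreFlux {d w : ℕ} (m : Vec d → Fin d → Fin w → ℝ) (p q : Vec d → ℝ) (x : Vec d) : Vec d :=
  fun i => p x * mV m x (mT m x fun i => score q x i - score p x i) i

lemma contDiff_scoreFlux {d w : ℕ} {m : Vec d → Fin d → Fin w → ℝ} (hm : ContDiff ℝ 1 m)
    {p q : Vec d → ℝ} (hp : ContDiff ℝ 1 p) (hsp : ContDiff ℝ 1 (score p))
    (hsq : ContDiff ℝ 1 (score q)) : ContDiff ℝ 1 (scoreFlux m p q) :=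
  contDiff_pi.2 fun i => hp.mul (contDiff_pi.1 (contDiff_mV_mT hm
    (contDiff_pi.2 fun k => (contDiff_pi.1 hsq k).sub (contDiff_pi.1 hsp k))) i)

lemma divg_scoreFlux {d w : ℕ} {m : Vec d → Fin d → Fin w → ℝ} (hm : ContDiff ℝ 1 m)
    {p q : Vec d → ℝ} (hp : ContDiff ℝ 1 p) (hpos : ∀ x, 0 < p x) (hsp : ContDiff ℝ 1 (score p))
    (hsq : ContDiff ℝ 1 (score q)) (x : Vec d) :
    divg (scoreFlux m p q) x = p x * (Zstat m q p x
      - (1/2) * ∑ j, (mT m x (fun i => score p x i - score q x i) j) ^ 2) := by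
  have hVp := contDiff_mV_mT hm hsp
  have hVq := contDiff_mV_mT hm hsq
  have hu : ContDiff ℝ 1 fun y => (fun i => score q y i - score p y i : Vec d) :=
    contDiff_pi.2 fun k => (contDiff_pi.1 hsq k).sub (contDiff_pi.1 hsp k)
  have hV := contDiff_mV_mT hm hu
  have hsub : divg (fun y => mV m y (mT m y fun i => score q y i - score p y i)) x
      = divg (fun y => mV m y (mT m y (score q y))) x
        - divg (fun y => mV m y (mT m y (score p y))) x := by
    rw [← divg_sub (hVq.differentiable one_ne_zero x) (hVp.differentiable one_ne_zero x)]
    congr 1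
    funext y i
    exact mV_mT_sub m y _ _ i
  have h1 := divg_mul (x := x) (hp.differentiable one_ne_zero x)
    (hV.differentiable one_ne_zero x)
  unfold scoreFlux
  rw [h1, hsub]
  simp only [fderiv_eq_mul_score (hp.differentiable one_ne_zero x) (hpos x), mul_assoc,
    ← Finset.mul_sum, sum_mul_mV_mT]
  have h2 : ∑ j, mT m x (score p x) j * mT m x (fun i => score q x i - score p x i) j
      = (1/2) * ∑ j, mT m x (score q x) j ^ 2 - (1/2) * ∑ j, mT m x (score p x) j ^ 2
        - (1/2) * ∑ j, mT m x (fun i => score p x i - score q x i) j ^ 2 := by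
    simp only [Finset.mul_sum, ← Finset.sum_sub_distrib, mT_sub]
    exact Finset.sum_congr rfl fun j _ => by ring
  rw [h2, Zstat, Sm, Sm]
  ring

lemma fderiv_bump_log {d : ℕ} (η : ContDiffBump (0 : ℝ)) {p : Vec d → ℝ} (hp : ContDiff ℝ 1 p)
    (hpos : ∀ x, 0 < p x) (c : ℝ) (x : Vec d) (i : Fin d) :
    fderiv ℝ (fun y => η (Real.log (p y) / c)) x (Pi.single i 1)
      = deriv η (Real.log (p x) / c) / c * score p x i := by
  have hl : DifferentiableAt ℝ (fun y => Real.log (p y)) x :=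
    (hp.differentiable one_ne_zero x).log (hpos x).ne'
  have hη : DifferentiableAt ℝ η (Real.log (p x) / c) :=
    (η.contDiff (n := 1)).differentiable one_ne_zero _
  have h := hη.hasDerivAt.comp_hasFDerivAt x (hl.hasFDerivAt.mul_const c⁻¹)
  have h' : HasFDerivAt (fun y => η (Real.log (p y) / c)) _ x := h
  rw [h'.fderiv]
  simp [score, div_eq_mul_inv, mul_assoc]

lemma abs_log_lt_of_bump_ne_zero {η : ContDiffBump (0 : ℝ)} {t c : ℝ} (hc : 0 < c)
    (h : η (t / c) ≠ 0) : |t| < η.rOut * c := by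
  by_contra! hle
  refine h (η.zero_of_le_dist ?_)
  rwa [dist_zero_right, Real.norm_eq_abs, abs_div, abs_of_pos hc, le_div_iff₀ hc]

/-- Truncating to bounded `log p` and `log q` makes the score flux integrable. -/
lemma integrable_bump_mul_scoreFlux {d w : ℕ} {m : Vec d → Fin d → Fin w → ℝ}
    (hm : ContDiff ℝ 1 m) {p q : Vec d → ℝ} (hp : ContDiff ℝ 1 p) (hq : ContDiff ℝ 1 q)
    (hppos : ∀ x, 0 < p x) (hqpos : ∀ x, 0 < q x)
    (hsp : ContDiff ℝ 1 (score p)) (hsq : ContDiff ℝ 1 (score q)) (hpint : Integrable p)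
    (hqp : Tendsto (fun x => (fun i => q x * mV m x (mT m x (score p x)) i : Vec d))
      (atInfty d) (𝓝 0))
    (hpq : Tendsto (fun x => (fun i => p x * mV m x (mT m x (score q x)) i : Vec d))
      (atInfty d) (𝓝 0))
    (η : ContDiffBump (0 : ℝ)) {c : ℝ} (hc : 0 < c) (i : Fin d) :
    Integrable fun x => η (Real.log (p x) / c) * η (Real.log (q x) / c)
      * scoreFlux m p q x i := by
  have hcont : ∀ {f g : Vec d → ℝ}, ContDiff ℝ 1 f → ContDiff ℝ 1 (score g) →
      Continuous fun x => (fun i => f x * mV m x (mT m x (score g x)) i : Vec d) := by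
    intro f g hf hg
    exact continuous_pi fun i => hf.continuous.mul
      (contDiff_pi.1 (contDiff_mV_mT hm hg) i).continuous
  obtain ⟨A, hA⟩ := exists_norm_le_of_tendsto_atInfty (hcont hq hsp) hqp
  obtain ⟨B, hB⟩ := exists_norm_le_of_tendsto_atInfty (hcont hp hsq) hpq
  have hA0 : 0 ≤ A := (norm_nonneg _).trans (hA 0)
  have hB0 : 0 ≤ B := (norm_nonneg _).trans (hB 0)
  set L := η.rOut * c
  refine (hpint.const_mul ((B + Real.exp (L + L) * A) * Real.exp L)).mono' ?_
    (ae_of_all _ fun x => ?_)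
  · have hlog : ∀ {f : Vec d → ℝ}, ContDiff ℝ 1 f → (∀ x, 0 < f x) →
        Continuous fun x => η (Real.log (f x) / c) := fun hf hfpos =>
      η.continuous.comp ((hf.continuous.log fun x => (hfpos x).ne').div_const c)
    exact (((hlog hp hppos).mul (hlog hq hqpos)).mul
      (contDiff_pi.1 (contDiff_scoreFlux hm hp hsp hsq) i).continuous).aestronglyMeasurable
  · have hp0 := hppos x
    have hq0 := hqpos x
    by_cases h0 : η (Real.log (p x) / c) * η (Real.log (q x) / c) = 0
    · rw [h0, zero_mul, norm_zero]
      positivity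
    obtain ⟨h1, h2⟩ := mul_ne_zero_iff.1 h0
    have hlp := abs_lt.1 (abs_log_lt_of_bump_ne_zero hc h1)
    have hlq := abs_lt.1 (abs_log_lt_of_bump_ne_zero hc h2)
    have hAi : |q x * mV m x (mT m x (score p x)) i| ≤ A :=
      (norm_le_pi_norm (fun i => q x * mV m x (mT m x (score p x)) i) i).trans (hA x)
    have hBi : |p x * mV m x (mT m x (score q x)) i| ≤ B :=
      (norm_le_pi_norm (fun i => p x * mV m x (mT m x (score q x)) i) i).trans (hB x)
    have hratio : p x / q x ≤ Real.exp (L + L) := by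
      rw [← Real.exp_log (div_pos hp0 hq0), Real.log_div hp0.ne' hq0.ne']
      exact Real.exp_le_exp.2 (by linarith)
    have hone : 1 ≤ Real.exp L * p x := by
      rw [← Real.exp_log hp0, ← Real.exp_add]
      exact Real.one_le_exp (by linarith)
    have hflux : |scoreFlux m p q x i| ≤ B + Real.exp (L + L) * A := by
      have heq : scoreFlux m p q x i = p x * mV m x (mT m x (score q x)) i
          - p x / q x * (q x * mV m x (mT m x (score p x)) i) := by
        rw [scoreFlux, mV_mT_sub]
        field_simp
      rw [heq]
      refine (abs_sub _ _).trans (add_le_add hBi ?_)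
      rw [abs_mul, abs_of_pos (div_pos hp0 hq0)]
      gcongr
    have hχ : η (Real.log (p x) / c) * η (Real.log (q x) / c) ≤ 1 :=
      mul_le_one₀ η.le_one η.nonneg η.le_one
    rw [Real.norm_eq_abs, abs_mul, abs_of_nonneg (mul_nonneg η.nonneg η.nonneg), mul_assoc _ _ (p x)]
    calc _ ≤ |scoreFlux m p q x i| := mul_le_of_le_one_left (abs_nonneg _) hχ
      _ ≤ B + Real.exp (L + L) * A := hflux
      _ ≤ _ := le_mul_of_one_le_right (by positivity) hone

lemma integral_divg_scoreFlux_eq_zero {d w : ℕ} {m : Vec d → Fin d → Fin w → ℝ}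
    (hm : ContDiff ℝ 1 m) {p q : Vec d → ℝ} (hp : ContDiff ℝ 1 p) (hq : ContDiff ℝ 1 q)
    (hppos : ∀ x, 0 < p x) (hqpos : ∀ x, 0 < q x)
    (hsp : ContDiff ℝ 1 (score p)) (hsq : ContDiff ℝ 1 (score q)) (hpint : Integrable p)
    (hEp : Integrable fun x => p x * ∑ j, (mT m x (score p x) j) ^ 2)
    (hEq : Integrable fun x => p x * ∑ j, (mT m x (score q x) j) ^ 2)
    (hqp : Tendsto (fun x => (fun i => q x * mV m x (mT m x (score p x)) i : Vec d))
      (atInfty d) (𝓝 0))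
    (hpq : Tendsto (fun x => (fun i => p x * mV m x (mT m x (score q x)) i : Vec d))
      (atInfty d) (𝓝 0))
    (hdiv : Integrable (divg (scoreFlux m p q))) :
    ∫ x, divg (scoreFlux m p q) x = 0 := by
  let η : ContDiffBump (0 : ℝ) := ⟨1, 2, one_pos, one_lt_two⟩
  have hη : ContDiff ℝ 1 η := η.contDiff
  obtain ⟨C, hC⟩ : ∃ C, ∀ t, ‖deriv η t‖ ≤ C :=
    (hη.continuous_deriv le_rfl).bounded_above_of_compact_support η.hasCompactSupport.deriv
  have hC0 : 0 ≤ C := (norm_nonneg _).trans (hC 0)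
  have hF := contDiff_scoreFlux hm hp hsp hsq
  have hcut : ∀ {f : Vec d → ℝ}, ContDiff ℝ 1 f → (∀ x, 0 < f x) → ∀ n : ℕ,
      ContDiff ℝ 1 fun x => η (Real.log (f x) / ((n : ℝ) + 1)) := fun hf hfpos n =>
    hη.comp ((hf.log fun x => (hfpos x).ne').div_const _)
  have hχ : ∀ n : ℕ, ContDiff ℝ 1 fun x =>
      η (Real.log (p x) / ((n : ℝ) + 1)) * η (Real.log (q x) / ((n : ℝ) + 1)) := fun n =>
    (hcut hp hppos n).mul (hcut hq hqpos n)
  refine integral_divg_eq_zero_of_cutoff hF hdiv hχ (fun n x => ?_) (fun x => ?_)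
    ((hEq.add hEp).const_mul (4 * C)) (fun n x => ?_) (fun n hn => ?_)
  · rw [abs_of_nonneg (mul_nonneg η.nonneg η.nonneg)]
    exact mul_le_one₀ η.le_one η.nonneg η.le_one
  · refine tendsto_const_nhds.congr' ?_
    filter_upwards [eventually_bump_div_eq_one η (Real.log (p x)),
      eventually_bump_div_eq_one η (Real.log (q x))] with n h1 h2
    rw [h1, h2, one_mul]
  · have hn : (0 : ℝ) < n + 1 := by positivity
    have hp0 := hppos x
    set N : ℝ := n + 1
    set α := η (Real.log (p x) / N)
    set β := η (Real.log (q x) / N)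
    set α' := deriv η (Real.log (p x) / N)
    set β' := deriv η (Real.log (q x) / N)
    set V := mV m x (mT m x fun i => score q x i - score p x i)
    set E := ∑ j, mT m x (score q x) j ^ 2 + ∑ j, mT m x (score p x) j ^ 2
    have hsum : ∑ i, fderiv ℝ (fun y => η (Real.log (p y) / N) * η (Real.log (q y) / N)) x
        (Pi.single i 1) * scoreFlux m p q x i
        = p x / N * (α * (β' * ∑ i, score q x i * V i) + β * (α' * ∑ i, score p x i * V i)) := by
      simp only [Finset.mul_sum, ← Finset.sum_add_distrib]
      refine Finset.sum_congr rfl fun i _ => ?_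
      rw [fderiv_fun_mul ((hcut hp hppos n).differentiable one_ne_zero x)
        ((hcut hq hqpos n).differentiable one_ne_zero x)]
      simp only [add_apply, smul_apply, smul_eq_mul]
      rw [fderiv_bump_log η hp hppos, fderiv_bump_log η hq hqpos, scoreFlux]
      ring
    have hterm : ∀ s s' t : ℝ, 0 ≤ s → s ≤ 1 → |s'| ≤ C → |t| ≤ 2 * E →
        |s * (s' * t)| ≤ C * (2 * E) := by
      intro s s' t hs0 hs1 hs' ht
      rw [abs_mul, abs_mul, abs_of_nonneg hs0]
      calc s * (|s'| * |t|) ≤ 1 * (C * (2 * E)) := by gcongr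
        _ = _ := one_mul _
    rw [hsum, abs_mul, abs_of_pos (div_pos hp0 hn)]
    have h1 := hterm α β' _ η.nonneg η.le_one (hC _)
      (abs_sum_mul_mV_mT_sub_le m x _ (score q x) (score p x) (Or.inl rfl))
    have h2 := hterm β α' _ η.nonneg η.le_one (hC _)
      (abs_sum_mul_mV_mT_sub_le m x _ (score q x) (score p x) (Or.inr rfl))
    calc _ ≤ p x / N * (C * (2 * E) + C * (2 * E)) := by
          gcongr
          exact (abs_add_le _ _).trans (add_le_add h1 h2)
      _ = _ := by
          simp only [Pi.add_apply, E]
          ring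
  · exact integral_divg_eq_zero
      (contDiff_pi.2 fun i => (hχ n).mul (contDiff_pi.1 hF i))
      (integrable_bump_mul_scoreFlux hm hp hq hppos hqpos hsp hsq hpint hqp hpq η
        (by positivity)) hn

lemma integrable_withDensity_ofReal_iff {d : ℕ} {p : Vec d → ℝ} (hp : Continuous p)
    (hpos : ∀ x, 0 < p x) (f : Vec d → ℝ) :
    Integrable f (volume.withDensity fun x => ENNReal.ofReal (p x))
      ↔ Integrable fun x => p x * f x := by
  rw [integrable_withDensity_iff_integrable_smul' hp.measurable.ennreal_ofReal
    (ae_of_all _ fun x => ENNReal.ofReal_lt_top)]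
  simp only [ENNReal.toReal_ofReal (hpos _).le, smul_eq_mul]

lemma integral_withDensity_ofReal {d : ℕ} {p : Vec d → ℝ} (hp : Continuous p)
    (hpos : ∀ x, 0 < p x) (f : Vec d → ℝ) :
    ∫ x, f x ∂(volume.withDensity fun x => ENNReal.ofReal (p x)) = ∫ x, p x * f x := by
  rw [integral_withDensity_eq_integral_toReal_smul hp.measurable.ennreal_ofReal
    (ae_of_all _ fun x => ENNReal.ofReal_lt_top)]
  simp only [ENNReal.toReal_ofReal (hpos _).le, smul_eq_mul]

/-- The post-change drift of the diffusion test statistic is the diffusion divergence. -/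
lemma integral_Zstat_eq_Dm {d w : ℕ} {P : Measure (Vec d)} [IsProbabilityMeasure P]
    {p q : Vec d → ℝ} (hP : P = volume.withDensity fun x => ENNReal.ofReal (p x))
    {m : Vec d → Fin d → Fin w → ℝ} (hm : ContDiff ℝ 1 m)
    (hp : ContDiff ℝ 1 p) (hq : ContDiff ℝ 1 q)
    (hppos : ∀ x, 0 < p x) (hqpos : ∀ x, 0 < q x)
    (hsp : ContDiff ℝ 1 (score p)) (hsq : ContDiff ℝ 1 (score q))
    (hEp : Integrable (fun x => ∑ j, (mT m x (score p x) j) ^ 2) P)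
    (hEq : Integrable (fun x => ∑ j, (mT m x (score q x) j) ^ 2) P)
    (hqp : Tendsto (fun x => (fun i => q x * mV m x (mT m x (score p x)) i : Vec d))
      (atInfty d) (𝓝 0))
    (hpq : Tendsto (fun x => (fun i => p x * mV m x (mT m x (score q x)) i : Vec d))
      (atInfty d) (𝓝 0))
    (hZ : Integrable (Zstat m q p) P) :
    ∫ x, Zstat m q p x ∂P = Dm P m p q := by
  have hpint : Integrable p := by
    have h := integrable_const (μ := P) (1 : ℝ)
    rw [hP, integrable_withDensity_ofReal_iff hp.continuous hppos] at h
    simpa using h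
  have hmij : ∀ i j, Continuous fun x => m x i j := fun i j =>
    (contDiff_pi.1 (contDiff_pi.1 hm i) j).continuous
  have hD : Integrable
      (fun x => (1/2) * ∑ j, (mT m x (fun i => score p x i - score q x i) j) ^ 2) P := by
    refine (hEp.add hEq).mono' ?_ (ae_of_all _ fun x => ?_)
    · refine Continuous.aestronglyMeasurable ?_
      refine continuous_const.mul (continuous_finsetSum _ fun j _ => Continuous.pow ?_ 2)
      exact continuous_finsetSum _ fun i _ => (hmij i j).mul
        ((contDiff_pi.1 hsp i).continuous.sub (contDiff_pi.1 hsq i).continuous)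
    · rw [Real.norm_eq_abs, abs_of_nonneg (by positivity), Pi.add_apply,
        ← Finset.sum_add_distrib, Finset.mul_sum]
      refine Finset.sum_le_sum fun j _ => ?_
      rw [mT_sub]
      nlinarith [sq_nonneg (mT m x (score p x) j + mT m x (score q x) j)]
  have hdiv : divg (scoreFlux m p q) = fun x => p x * (Zstat m q p x
      - (1/2) * ∑ j, (mT m x (fun i => score p x i - score q x i) j) ^ 2) :=
    funext (divg_scoreFlux hm hp hppos hsp hsq)
  have hint : Integrable (divg (scoreFlux m p q)) := by
    rw [hdiv, ← integrable_withDensity_ofReal_iff hp.continuous hppos, ← hP]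
    exact hZ.sub hD
  have hzero := integral_divg_scoreFlux_eq_zero hm hp hq hppos hqpos hsp hsq hpint
    ((integrable_withDensity_ofReal_iff hp.continuous hppos _).1 (hP ▸ hEp))
    ((integrable_withDensity_ofReal_iff hp.continuous hppos _).1 (hP ▸ hEq)) hqp hpq hint
  rw [hdiv, ← integral_withDensity_ofReal hp.continuous hppos, ← hP,
    integral_sub hZ hD, sub_eq_zero] at hzero
  exact hzero

/-- Strict Jensen step in the ARL proof: with `δ = −log E_{P∞}[exp Z_m] ≥ 0`,
the shifted drift is strictly negative, i.e.
`D_m(P∞‖P1) = −E_{P∞}[Z_m] > −log E_{P∞}[exp Z_m]`. -/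
theorem statement9 {d w : ℕ}
    (Pinf Pone : Measure (Vec d)) [IsProbabilityMeasure Pinf] [IsProbabilityMeasure Pone]
    (pinf pone : Vec d → ℝ)
    (hPinf : Pinf = volume.withDensity fun x => ENNReal.ofReal (pinf x))
    (hPone : Pone = volume.withDensity fun x => ENNReal.ofReal (pone x))
    (hne : Pinf ≠ Pone)
    (hpinf_pos : ∀ x, 0 < pinf x) (hpone_pos : ∀ x, 0 < pone x)
    (hpinf_smooth : ContDiff ℝ 2 pinf) (hpone_smooth : ContDiff ℝ 2 pone)
    (m : Vec d → Fin d → Fin w → ℝ) (hm : ContDiff ℝ 1 m)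
    (hreg1 : Reg Pinf pinf pone m) (hreg2 : Reg Pone pone pinf m)
    (hD1 : 0 < Dm Pinf m pinf pone) (hD2 : 0 < Dm Pone m pone pinf)
    (hint : Integrable (Zstat m pinf pone) Pinf)
    (hmean : ∫ x, Zstat m pinf pone x ∂Pinf = - Dm Pinf m pinf pone)
    (hexpint : Integrable (fun x => Real.exp (Zstat m pinf pone x)) Pinf)
    (hexp : ∫ x, Real.exp (Zstat m pinf pone x) ∂Pinf ≤ 1)
    (δ : ℝ) (hδ : δ = - Real.log (∫ x, Real.exp (Zstat m pinf pone x) ∂Pinf)) :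
    0 ≤ δ
    ∧ (∫ x, Zstat m pinf pone x ∂Pinf) + δ < 0
    ∧ - Real.log (∫ x, Real.exp (Zstat m pinf pone x) ∂Pinf) < Dm Pinf m pinf pone := by
  have hZ_ne : ¬ ∀ᵐ x ∂Pinf, Zstat m pinf pone x = - Dm Pinf m pinf pone := by
    intro hae
    have hac : Pone ≪ Pinf := by
      rw [hPone, hPinf]
      exact (withDensity_absolutelyContinuous _ _).trans
        (withDensity_absolutelyContinuous' hpinf_smooth.continuous.measurable.ennreal_ofReal.aemeasurable
          (ae_of_all _ fun x => (ENNReal.ofReal_pos.2 (hpinf_pos x)).ne'))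
    have hae' : Zstat m pinf pone =ᵐ[Pone] fun _ => - Dm Pinf m pinf pone := hac hae
    have h := integral_Zstat_eq_Dm hPone hm (hpone_smooth.of_le one_le_two)
      (hpinf_smooth.of_le one_le_two) hpone_pos hpinf_pos hreg1.1 hreg2.1
      hreg2.2.2.1 hreg2.2.1 hreg2.2.2.2 hreg1.2.2.2
      ((integrable_congr hae').2 (integrable_const _))
    rw [integral_congr_ae hae', integral_const] at h
    simp only [probReal_univ, one_smul] at h
    linarith
  have hjensen : Real.exp (∫ x, Zstat m pinf pone x ∂Pinf)
      < ∫ x, Real.exp (Zstat m pinf pone x) ∂Pinf := by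
    rcases strictConvexOn_exp.ae_eq_const_or_map_average_lt Real.continuous_exp.continuousOn
      isClosed_univ (ae_of_all _ fun _ => Set.mem_univ _) hint hexpint with h | h
    · rw [average_eq_integral, hmean] at h
      exact (hZ_ne h).elim
    · rwa [average_eq_integral, average_eq_integral] at h
  have hlt := (Real.lt_log_iff_exp_lt ((Real.exp_pos _).trans hjensen)).2 hjensen
  have hnonpos := Real.log_nonpos ((Real.exp_pos _).trans hjensen).le hexp
  refine ⟨by linarith, by linarith, by linarith⟩
end
end

section
/- Let V ∈ ℝ^{d×d} be symmetric positive definite, μ ∈ ℝ^d, P∞ = N(0, V) and P1 = N(μ, V). For any fixed matrix M ∈ ℝ^{d×w} taken as constant diffusion matrix function m(X) ≡ M, the diffusion test statistic is Z_M(X) = Xᵀ V⁻¹ M Mᵀ V⁻¹ μ − (1/2) μᵀ V⁻¹ M Mᵀ V⁻¹ μ for all X ∈ ℝ^d, while the log-likelihood ratio is Z_KL(X) = Xᵀ V⁻¹ μ − (1/2) μᵀ V⁻¹ μ. -/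
open MeasureTheory ProbabilityTheory Filter Topology
open scoped ENNReal

noncomputable section

open Matrix in
/-- Density of the multivariate Gaussian `N(μ, V)` on `ℝ^d`. -/
def gaussD {d : ℕ} (μv : Vec d) (V : Matrix (Fin d) (Fin d) ℝ) (x : Vec d) : ℝ :=
  (Real.sqrt ((2 * Real.pi) ^ (d : ℕ) * V.det))⁻¹ *
    Real.exp (-(1/2) * ((fun i => x i - μv i) ⬝ᵥ (V⁻¹ *ᵥ fun i => x i - μv i)))
open Matrix in
theorem log_gaussD {d : ℕ} (μv : Vec d) {V : Matrix (Fin d) (Fin d) ℝ} (hV : V.PosDef)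
    (x : Vec d) :
    Real.log (gaussD μv V x) = Real.log (Real.sqrt ((2 * Real.pi) ^ d * V.det))⁻¹
      + -(1/2) * ((x - μv) ⬝ᵥ (V⁻¹ *ᵥ (x - μv))) := by
  have hdet := hV.det_pos
  have hc : (Real.sqrt ((2 * Real.pi) ^ d * V.det))⁻¹ ≠ 0 := by positivity
  unfold gaussD
  rw [Real.log_mul hc (Real.exp_ne_zero _), Real.log_exp]
  rfl

open Matrix in
theorem dotProduct_mulVec_comm_of_isSymm {d : ℕ} {A : Matrix (Fin d) (Fin d) ℝ} (hA : A.IsSymm)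
    (u v : Vec d) : u ⬝ᵥ (A *ᵥ v) = v ⬝ᵥ (A *ᵥ u) := by
  rw [dotProduct_mulVec, ← mulVec_transpose, hA.eq, dotProduct_comm]

open Matrix in
theorem fderiv_quadraticForm_apply {d : ℕ} {A : Matrix (Fin d) (Fin d) ℝ} (hA : A.IsSymm)
    (c : ℝ) (a x v : Vec d) :
    fderiv ℝ (fun y : Vec d => c + -(1/2) * ((y - a) ⬝ᵥ (A *ᵥ (y - a)))) x v
      = -(v ⬝ᵥ (A *ᵥ (x - a))) := by
  have hdiff : DifferentiableAt ℝ
      (fun y : Vec d => c + -(1/2) * ((y - a) ⬝ᵥ (A *ᵥ (y - a)))) x := by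
    simp only [dotProduct, mulVec, Pi.sub_apply]
    fun_prop
  rw [← hdiff.lineDeriv_eq_fderiv, lineDeriv]
  have hline : (fun t : ℝ => c + -(1/2) * ((x + t • v - a) ⬝ᵥ (A *ᵥ (x + t • v - a))))
      = fun t : ℝ => c + -(1/2) * ((x - a) ⬝ᵥ (A *ᵥ (x - a)))
        + (t * -(v ⬝ᵥ (A *ᵥ (x - a))) + t ^ 2 * (-(1/2) * (v ⬝ᵥ (A *ᵥ v)))) := by
    funext t
    rw [show x + t • v - a = (x - a) + t • v by abel]
    simp only [mulVec_add, mulVec_smul, dotProduct_add, add_dotProduct, smul_dotProduct,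
      dotProduct_smul, smul_eq_mul]
    rw [dotProduct_mulVec_comm_of_isSymm hA (x - a) v]
    ring
  rw [hline]
  have h := (((hasDerivAt_id (0 : ℝ)).mul_const (-(v ⬝ᵥ (A *ᵥ (x - a))))).add
    (((hasDerivAt_id (0 : ℝ)).pow 2).mul_const (-(1/2) * (v ⬝ᵥ (A *ᵥ v))))).const_add
    (c + -(1/2) * ((x - a) ⬝ᵥ (A *ᵥ (x - a))))
  simpa using h.deriv

open Matrix in
theorem isSymm_inv_of_posDef {d : ℕ} {V : Matrix (Fin d) (Fin d) ℝ} (hV : V.PosDef) :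
    (V⁻¹).IsSymm := by
  simpa [IsHermitian, IsSymm] using hV.isHermitian.inv

open Matrix in
theorem score_gaussD {d : ℕ} (μv : Vec d) {V : Matrix (Fin d) (Fin d) ℝ} (hV : V.PosDef)
    (x : Vec d) : score (gaussD μv V) x = -(V⁻¹ *ᵥ (x - μv)) := by
  funext i
  simp only [score, log_gaussD μv hV]
  rw [fderiv_quadraticForm_apply (isSymm_inv_of_posDef hV), single_one_dotProduct]
  rfl

theorem divg_add_const {d : ℕ} (f : Vec d → Vec d) (b x : Vec d) :
    divg (fun y => f y + b) x = divg f x := by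
  simp only [divg, Pi.add_apply, fderiv_add_const]

open Matrix in
theorem Sm_const_gaussD {d w : ℕ} (μv : Vec d) {V : Matrix (Fin d) (Fin d) ℝ} (hV : V.PosDef)
    (M : Matrix (Fin d) (Fin w) ℝ) (x : Vec d) :
    Sm (fun _ i j => M i j) (gaussD μv V) x
      = (1/2) * ((x - μv) ⬝ᵥ (V⁻¹ *ᵥ (M *ᵥ (Mᵀ *ᵥ (V⁻¹ *ᵥ (x - μv))))))
        + divg (fun y => -(M *ᵥ (Mᵀ *ᵥ (V⁻¹ *ᵥ y)))) x := by
  have hT (y v : Vec d) : mT (fun _ i j => M i j) y v = Mᵀ *ᵥ v := rfl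
  have hM (y : Vec d) (u : Fin w → ℝ) : mV (fun _ i j => M i j) y u = M *ᵥ u := rfl
  simp only [Sm, hT, hM, score_gaussD μv hV]
  congr 1
  · rw [dotProduct_mulVec, ← mulVec_transpose, (isSymm_inv_of_posDef hV).eq, dotProduct_mulVec,
      ← mulVec_transpose]
    simp [dotProduct, mulVec_neg, sq]
  · rw [← divg_add_const (fun y => -(M *ᵥ (Mᵀ *ᵥ (V⁻¹ *ᵥ y)))) (M *ᵥ (Mᵀ *ᵥ (V⁻¹ *ᵥ μv)))]
    congr 1
    funext y
    simp only [mulVec_sub, mulVec_neg]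
    abel

open Matrix in
theorem half_quadraticForm_sub {d : ℕ} {A : Matrix (Fin d) (Fin d) ℝ} (hA : A.IsSymm)
    (x a : Vec d) :
    (1/2) * (x ⬝ᵥ (A *ᵥ x)) - (1/2) * ((x - a) ⬝ᵥ (A *ᵥ (x - a)))
      = x ⬝ᵥ (A *ᵥ a) - (1/2) * (a ⬝ᵥ (A *ᵥ a)) := by
  simp only [mulVec_sub, dotProduct_sub, sub_dotProduct]
  rw [dotProduct_mulVec_comm_of_isSymm hA a x]
  ring

open Matrix in
/-- Explicit Gaussian formulas: for `P∞ = N(0, V)`, `P1 = N(μ, V)` and a constant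
diffusion matrix `M ∈ ℝ^{d×w}`,
`Z_M(X) = Xᵀ V⁻¹ M Mᵀ V⁻¹ μ − (1/2) μᵀ V⁻¹ M Mᵀ V⁻¹ μ`, while
`Z_KL(X) = Xᵀ V⁻¹ μ − (1/2) μᵀ V⁻¹ μ`. -/
theorem statement15 {d w : ℕ} (μv : Vec d)
    (V : Matrix (Fin d) (Fin d) ℝ) (hV : V.PosDef)
    (M : Matrix (Fin d) (Fin w) ℝ) :
    (∀ X : Vec d,
        Zstat (fun _ i j => M i j) (gaussD 0 V) (gaussD μv V) X
          = X ⬝ᵥ (V⁻¹ *ᵥ (M *ᵥ (Mᵀ *ᵥ (V⁻¹ *ᵥ μv))))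
            - (1/2) * (μv ⬝ᵥ (V⁻¹ *ᵥ (M *ᵥ (Mᵀ *ᵥ (V⁻¹ *ᵥ μv))))))
    ∧ (∀ X : Vec d,
        Real.log (gaussD μv V X) - Real.log (gaussD 0 V X)
          = X ⬝ᵥ (V⁻¹ *ᵥ μv) - (1/2) * (μv ⬝ᵥ (V⁻¹ *ᵥ μv))) := by
  have hsymm := isSymm_inv_of_posDef hV
  constructor
  · intro X
    have hA : (V⁻¹ * (M * (Mᵀ * V⁻¹))).IsSymm := by
      simp only [IsSymm, transpose_mul, transpose_transpose, hsymm.eq, Matrix.mul_assoc]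
    have h := half_quadraticForm_sub hA X μv
    simp only [← mulVec_mulVec] at h
    rw [Zstat, Sm_const_gaussD 0 hV, Sm_const_gaussD μv hV, ← h, sub_zero]
    ring
  · intro X
    rw [log_gaussD μv hV, log_gaussD 0 hV, ← half_quadraticForm_sub hsymm X μv, sub_zero]
    ring
end
end

section
/- Let P∞ = N(0, 1/4) and P1 = N(0, 1) be scalar Gaussian distributions on ℝ. For every w ∈ ℕ and every continuously differentiable m : ℝ → ℝ^{1×w} such that the diffusion divergence D_m(P1‖P∞) is finite, the diffusion test statistic does not agree with the log-likelihood ratio almost everywhere: P∞({X : Z_m(X) ≠ Z_KL(X)}) > 0 and P1({X : Z_m(X) ≠ Z_KL(X)}) > 0. -/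
open MeasureTheory ProbabilityTheory Filter Topology
open scoped ENNReal

noncomputable section

/-- Scalar score `(log p)′`. -/
def score1 (p : ℝ → ℝ) (x : ℝ) : ℝ := deriv (fun y => Real.log (p y)) x

/-- One-dimensional diffusion-Hyvärinen score for a row-vector-valued
`m : ℝ → ℝ^{1×w}`:
`S_m(x, P) = (1/2)‖m(x)ᵀ (log p)′(x)‖² + (m(x) m(x)ᵀ (log p)′(x))′`. -/
def S1 {w : ℕ} (m : ℝ → Fin w → ℝ) (p : ℝ → ℝ) (x : ℝ) : ℝ :=
  (1/2) * ∑ j, (m x j * score1 p x) ^ 2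
    + deriv (fun y => (∑ j, (m y j) ^ 2) * score1 p y) x

/-- One-dimensional diffusion test statistic `Z_m(x) = S_m(x, P∞) − S_m(x, P1)`. -/
def Z1 {w : ℕ} (m : ℝ → Fin w → ℝ) (pinf pone : ℝ → ℝ) (x : ℝ) : ℝ :=
  S1 m pinf x - S1 m pone x
open scoped NNReal

lemma log_gaussianPDFReal (μ : ℝ) {v : ℝ≥0} (hv : v ≠ 0) (x : ℝ) :
    Real.log (gaussianPDFReal μ v x)
      = -Real.log (2 * Real.pi * v) / 2 - (x - μ) ^ 2 / (2 * v) := by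
  have hv' : (0 : ℝ) < v := by positivity
  have h : (0 : ℝ) < 2 * Real.pi * v := by positivity
  rw [gaussianPDFReal, Real.log_mul (by positivity) (Real.exp_ne_zero _), Real.log_exp,
    Real.log_inv, Real.log_sqrt h.le]
  ring

lemma score1_gaussianPDFReal (μ : ℝ) {v : ℝ≥0} (hv : v ≠ 0) (x : ℝ) :
    score1 (fun y => gaussianPDFReal μ v y) x = -(x - μ) / v := by
  have hv' : (v : ℝ) ≠ 0 := by exact_mod_cast hv
  simp only [score1, log_gaussianPDFReal μ hv]
  have h : HasDerivAt (fun y : ℝ => -Real.log (2 * Real.pi * v) / 2 - (y - μ) ^ 2 / (2 * v))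
      (-(2 * (x - μ) / (2 * v))) x := by
    have := ((((hasDerivAt_id x).sub_const μ).pow 2).div_const (2 * (v : ℝ))).const_sub
      (-Real.log (2 * Real.pi * v) / 2)
    simpa using this
  rw [h.deriv]
  field_simp

lemma score1_gaussianPDFReal_zero_one (x : ℝ) :
    score1 (fun y => gaussianPDFReal 0 1 y) x = -x := by
  rw [score1_gaussianPDFReal 0 one_ne_zero]
  simp

lemma score1_gaussianPDFReal_zero_quarter (x : ℝ) :
    score1 (fun y => gaussianPDFReal 0 (1/4) y) x = -(4 * x) := by
  rw [score1_gaussianPDFReal 0 (by norm_num)]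
  push_cast
  ring

lemma log_gaussianPDFReal_one_sub_quarter (x : ℝ) :
    Real.log (gaussianPDFReal 0 1 x) - Real.log (gaussianPDFReal 0 (1/4) x)
      = 3 / 2 * x ^ 2 - Real.log 2 := by
  rw [log_gaussianPDFReal 0 one_ne_zero, log_gaussianPDFReal 0 (by norm_num)]
  have h : Real.log (2 * Real.pi * ((1 / 4 : ℝ≥0) : ℝ))
      = Real.log (2 * Real.pi) - 2 * Real.log 2 := by
    rw [show (2 * Real.pi * ((1 / 4 : ℝ≥0) : ℝ)) = 2 * Real.pi / 2 ^ 2 by push_cast; ring,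
      Real.log_div (by positivity) (by norm_num), Real.log_pow]
    push_cast
    ring
  rw [h]
  push_cast
  ring_nf

/-- The diffusion statistic of the two Gaussians in terms of `‖m‖²`. -/
lemma Z1_gaussianPDFReal {w : ℕ} {m : ℝ → Fin w → ℝ} {x : ℝ}
    (hf : DifferentiableAt ℝ (fun y => ∑ j, m y j ^ 2) x) :
    Z1 m (fun y => gaussianPDFReal 0 (1/4) y) (fun y => gaussianPDFReal 0 1 y) x
      = 15 / 2 * (∑ j, m x j ^ 2) * x ^ 2
        - 3 * (∑ j, m x j ^ 2 + x * deriv (fun y => ∑ j, m y j ^ 2) x) := by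
  simp only [Z1, S1, score1_gaussianPDFReal_zero_one, score1_gaussianPDFReal_zero_quarter]
  have h1 := (hf.hasDerivAt.mul (hasDerivAt_id x).neg).deriv
  have h4 := (hf.hasDerivAt.mul ((hasDerivAt_id x).const_mul 4).neg).deriv
  simp only [Pi.mul_def, Pi.neg_def, id] at h1 h4
  rw [h1, h4]
  simp only [mul_pow, ← Finset.sum_mul]
  ring

/-- Solutions of the equation `Z_m = Z_KL` grow at least like `exp (x² / 2)`. -/
lemma exists_exp_le_of_ode {f : ℝ → ℝ} (hf : Differentiable ℝ f)
    (h : ∀ x, 15 / 2 * f x * x ^ 2 - 3 * (f x + x * deriv f x)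
      = 3 / 2 * x ^ 2 - Real.log 2) :
    ∃ c > 0, ∀ x ≥ 1, c * Real.exp (x ^ 2 / 2) ≤ x * f x := by
  let k : ℝ → ℝ := fun x => (x * f x - x / 5) * Real.exp (-(5 / 4 * x ^ 2))
  have hk : ∀ x, HasDerivAt k
      ((Real.log 2 / 3 - 1 / 5) * Real.exp (-(5 / 4 * x ^ 2))) x := fun x => by
    have h1 := ((hasDerivAt_id x).mul (hf x).hasDerivAt).sub ((hasDerivAt_id x).div_const 5)
    have h2 := (((hasDerivAt_id x).pow 2).const_mul (5 / 4 : ℝ)).neg.exp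
    refine (h1.mul h2).congr_deriv ?_
    simp
    linear_combination (-1 / 3 * Real.exp (-(5 / 4 * x ^ 2))) * h x
  have hmono : StrictMono k := strictMono_of_deriv_pos fun x => by
    rw [(hk x).deriv]
    have := Real.log_two_gt_d9
    exact mul_pos (by linarith) (Real.exp_pos _)
  have hc : 0 < k 1 := by
    have := hmono zero_lt_one
    simpa [k] using this
  refine ⟨k 1, hc, fun x hx => ?_⟩
  have h1 : k 1 ≤ k x := hmono.monotone hx
  have h0 : 0 ≤ k x := hc.le.trans h1
  have h2 : k x * Real.exp (5 / 4 * x ^ 2) = x * f x - x / 5 := by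
    simp only [k]
    rw [mul_assoc, ← Real.exp_add]
    simp
  have h3 : Real.exp (x ^ 2 / 2) ≤ Real.exp (5 / 4 * x ^ 2) :=
    Real.exp_le_exp.mpr (by nlinarith [sq_nonneg x])
  calc k 1 * Real.exp (x ^ 2 / 2) ≤ k x * Real.exp (5 / 4 * x ^ 2) := by gcongr
    _ ≤ x * f x := by rw [h2]; linarith

lemma not_integrable_gaussianReal_of_exp_le {F : ℝ → ℝ} {c : ℝ} (hc : 0 < c)
    (hF : ∀ x ≥ 1, c * Real.exp (x ^ 2 / 2) ≤ F x) :
    ¬ Integrable F (gaussianReal 0 1) := by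
  intro hint
  rw [gaussianReal_of_var_ne_zero 0 one_ne_zero,
    integrable_withDensity_iff_integrable_smul' (measurable_gaussianPDF 0 1)
      (ae_of_all _ fun _ => gaussianPDF_lt_top)] at hint
  have hd : 0 < (√(2 * Real.pi))⁻¹ * c := by positivity
  have hconst : IntegrableOn (fun _ : ℝ => (√(2 * Real.pi))⁻¹ * c) (Set.Ici 1) := by
    refine Integrable.mono' hint.integrableOn aestronglyMeasurable_const ?_
    filter_upwards [ae_restrict_mem measurableSet_Ici] with x hx
    rw [Real.norm_of_nonneg hd.le, toReal_gaussianPDF, smul_eq_mul]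
    calc (√(2 * Real.pi))⁻¹ * c
        = gaussianPDFReal 0 1 x * (c * Real.exp (x ^ 2 / 2)) := by
          have he : Real.exp (-x ^ 2 / 2) * Real.exp (x ^ 2 / 2) = 1 := by
            rw [← Real.exp_add, neg_div, neg_add_cancel, Real.exp_zero]
          simp only [gaussianPDFReal, NNReal.coe_one, mul_one, sub_zero]
          linear_combination -((√(2 * Real.pi))⁻¹ * c) * he
      _ ≤ gaussianPDFReal 0 1 x * F x :=
          mul_le_mul_of_nonneg_left (hF x hx) (gaussianPDFReal_nonneg 0 1 x)
  rw [integrableOn_const_iff] at hconst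
  rcases hconst with h | h
  · exact hd.ne' (enorm_eq_zero.mp h)
  · simp at h

/-- With finite diffusion divergence, `Z_m` and `Z_KL` differ on a set of positive
Lebesgue measure. -/
lemma not_ae_Z1_eq_llr {w : ℕ} {m : ℝ → Fin w → ℝ} (hm : ContDiff ℝ 1 m)
    (hint : Integrable (fun x => (1/2) * ∑ j,
          (m x j * (score1 (fun y => gaussianPDFReal 0 1 y) x
            - score1 (fun y => gaussianPDFReal 0 (1/4) y) x)) ^ 2)
        (gaussianReal 0 1)) :
    ¬ ∀ᵐ x : ℝ,
      Z1 m (fun y => gaussianPDFReal 0 (1/4) y) (fun y => gaussianPDFReal 0 1 y) x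
        = Real.log (gaussianPDFReal 0 1 x) - Real.log (gaussianPDFReal 0 (1/4) x) := by
  intro hae
  have hf : ContDiff ℝ 1 (fun y => ∑ j, m y j ^ 2) :=
    ContDiff.sum fun j _ => (contDiff_pi.mp hm j).pow 2
  have hfd : Differentiable ℝ (fun y => ∑ j, m y j ^ 2) := hf.differentiable one_ne_zero
  have hf' : Continuous (deriv fun y => ∑ j, m y j ^ 2) := hf.continuous_deriv le_rfl
  have hfc := hf.continuous
  simp only [Z1_gaussianPDFReal (hfd _), log_gaussianPDFReal_one_sub_quarter] at hae
  have heq := (Continuous.ae_eq_iff_eq (volume : Measure ℝ) (by fun_prop) (by fun_prop)).mp hae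
  obtain ⟨c, hc, hle⟩ := exists_exp_le_of_ode hfd (congrFun heq)
  refine not_integrable_gaussianReal_of_exp_le hc (fun x hx => (hle x hx).trans ?_) hint
  simp only [score1_gaussianPDFReal_zero_one, score1_gaussianPDFReal_zero_quarter, mul_pow,
    ← Finset.sum_mul]
  have hnn : 0 ≤ ∑ j, m x j ^ 2 := Finset.sum_nonneg fun j _ => sq_nonneg _
  nlinarith [mul_nonneg hnn (show (0 : ℝ) ≤ 9 / 2 * x ^ 2 - x by nlinarith)]

lemma gaussianReal_pos_of_not_ae {v : ℝ≥0} (hv : v ≠ 0) {f g : ℝ → ℝ}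
    (h : ¬ ∀ᵐ x : ℝ, f x = g x) : 0 < gaussianReal 0 v {x | f x ≠ g x} :=
  pos_iff_ne_zero.mpr fun h0 => h (gaussianReal_absolutelyContinuous' 0 hv h0)

/-- No diffusion matrix recovers the LLR for `P∞ = N(0, 1/4)`, `P1 = N(0, 1)`
(Theorem 5): for every `w` and every continuously differentiable `m : ℝ → ℝ^{1×w}`
with finite diffusion divergence `D_m(P1‖P∞)`, the set `{Z_m ≠ Z_KL}` has positive
probability under both `P∞` and `P1`. -/
theorem statement16 :
    ∀ (w : ℕ) (m : ℝ → Fin w → ℝ), ContDiff ℝ 1 m →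
      Integrable (fun x => (1/2) * ∑ j,
          (m x j * (score1 (fun y => gaussianPDFReal 0 1 y) x
            - score1 (fun y => gaussianPDFReal 0 (1/4) y) x)) ^ 2)
        (gaussianReal 0 1) →
      0 < gaussianReal 0 (1/4)
          {x : ℝ | Z1 m (fun y => gaussianPDFReal 0 (1/4) y) (fun y => gaussianPDFReal 0 1 y) x
            ≠ Real.log (gaussianPDFReal 0 1 x) - Real.log (gaussianPDFReal 0 (1/4) x)}
      ∧ 0 < gaussianReal 0 1
          {x : ℝ | Z1 m (fun y => gaussianPDFReal 0 (1/4) y) (fun y => gaussianPDFReal 0 1 y) x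
            ≠ Real.log (gaussianPDFReal 0 1 x) - Real.log (gaussianPDFReal 0 (1/4) x)} := by
  intro w m hm hint
  have h := not_ae_Z1_eq_llr hm hint
  exact ⟨gaussianReal_pos_of_not_ae (by norm_num) h, gaussianReal_pos_of_not_ae one_ne_zero h⟩
end
end

section
/- Let d = 1, let P∞ and P1 be probability distributions on ℝ with everywhere-positive twice continuously differentiable densities p∞, p1, and write s∞ = (log p∞)′ and s1 = (log p1)′. For any continuously differentiable m : ℝ → ℝ^{1×w}, setting u(X) = Σ_{i=1}^w m_i(X)² = ‖m(X)‖², the diffusion test statistic satisfies, for all X ∈ ℝ: Z_m(X) = u(X)·((1/2)(s∞(X)² − s1(X)²) + s∞′(X) − s1′(X)) + u′(X)·(s∞(X) − s1(X)). In particular, Z_m depends on m only through the scalar function u = ‖m‖². -/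
open MeasureTheory ProbabilityTheory Filter Topology
open scoped ENNReal

noncomputable section

/-- The score of a positive `C²` density is differentiable. -/
lemma differentiable_score1 {p : ℝ → ℝ} (hpos : ∀ x, 0 < p x) (hp : ContDiff ℝ 2 p) :
    Differentiable ℝ (score1 p) := by
  have hlog : ContDiff ℝ (1 + 1) fun y => Real.log (p y) :=
    (hp.log fun x => (hpos x).ne').of_le (by norm_num)
  exact hlog.deriv'.differentiable one_ne_zero

/-- The diffusion-Hyvärinen score in terms of `‖m‖²`, by the product rule. -/
lemma S1_eq {w : ℕ} {m : ℝ → Fin w → ℝ} {p : ℝ → ℝ} {x : ℝ}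
    (hu : DifferentiableAt ℝ (fun y => ∑ j, (m y j) ^ 2) x)
    (hs : DifferentiableAt ℝ (score1 p) x) :
    S1 m p x = (∑ j, (m x j) ^ 2) * ((1/2) * (score1 p x) ^ 2 + deriv (score1 p) x)
      + deriv (fun y => ∑ j, (m y j) ^ 2) x * score1 p x := by
  simp only [S1, mul_pow, ← Finset.sum_mul]
  rw [deriv_fun_mul hu hs]
  ring

/-- One-dimensional reduction: with `u(X) = Σ_j m_j(X)² = ‖m(X)‖²`,
`Z_m(X) = u(X)((1/2)(s∞² − s1²) + s∞′ − s1′)(X) + u′(X)(s∞ − s1)(X)`;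
in particular `Z_m` depends on `m` only through `u`. -/
theorem statement17 {w : ℕ}
    (Pinf Pone : Measure ℝ) [IsProbabilityMeasure Pinf] [IsProbabilityMeasure Pone]
    (pinf pone : ℝ → ℝ)
    (hPinf : Pinf = volume.withDensity fun x => ENNReal.ofReal (pinf x))
    (hPone : Pone = volume.withDensity fun x => ENNReal.ofReal (pone x))
    (hpinf_pos : ∀ x, 0 < pinf x) (hpone_pos : ∀ x, 0 < pone x)
    (hpinf_smooth : ContDiff ℝ 2 pinf) (hpone_smooth : ContDiff ℝ 2 pone)
    (m : ℝ → Fin w → ℝ) (hm : ContDiff ℝ 1 m) :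
    ∀ X : ℝ,
      Z1 m pinf pone X
        = (∑ j, (m X j) ^ 2)
            * ((1/2) * ((score1 pinf X) ^ 2 - (score1 pone X) ^ 2)
                + deriv (score1 pinf) X - deriv (score1 pone) X)
          + deriv (fun y => ∑ j, (m y j) ^ 2) X * (score1 pinf X - score1 pone X) := by
  intro X
  have hu : DifferentiableAt ℝ (fun y => ∑ j, (m y j) ^ 2) X :=
    DifferentiableAt.fun_sum fun j _ =>
      (differentiableAt_pi.1 (hm.differentiable one_ne_zero X) j).pow 2
  rw [Z1, S1_eq hu (differentiable_score1 hpinf_pos hpinf_smooth X),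
    S1_eq hu (differentiable_score1 hpone_pos hpone_smooth X)]
  ring
end
end
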